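/- arXiv:2102.11727 — 3 statements merged into one kernel-verified Lean document; each statement's English description precedes it below -/
import Mathlib

section
/- Let f = (f₁,…,f_q) be a tuple of real homogeneous polynomials in n+1 variables with deg fᵢ = dᵢ, D := max_i dᵢ, and let G ⊆ S^n be a δ-net, i.e., a finite set such that every x ∈ S^n has geodesic distance less than δ to some point of G. If D·δ < √2, then max_{x∈G} maxᵢ |fᵢ(x)| ≤ ‖f‖∞ ≤ (1 − D²δ²/2)^{-1} · max_{x∈G} maxᵢ |fᵢ(x)|. -/
open MvPolynomial

noncomputable def vnorm {m : ℕ} (v : Fin m → ℝ) : ℝ := Real.sqrt (∑ j, v j ^ 2)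

noncomputable def polySupNorm {n q : ℕ} (f : Fin q → MvPolynomial (Fin (n + 1)) ℝ) : ℝ :=
  ⨆ x : {x : Fin (n + 1) → ℝ // vnorm x = 1}, ⨆ i : Fin q, |eval x.1 (f i)|

/-- `max_{x ∈ G} max_i |f_i(x)|` over a finite grid `G` on the sphere. -/
noncomputable def gridMax {n q : ℕ} (G : Finset (Fin (n + 1) → ℝ))
    (f : Fin q → MvPolynomial (Fin (n + 1)) ℝ) : ℝ :=
  sSup {t : ℝ | ∃ x ∈ G, ∃ i : Fin q, t = |eval x (f i)|}

def TrigDeg (d : ℕ) (g : ℝ → ℝ) : Prop :=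
  ∃ p q : Polynomial ℝ, p.natDegree ≤ d ∧ q.natDegree ≤ d ∧ (Polynomial.X * q).natDegree ≤ d ∧
    ∀ t, g t = p.eval (Real.cos t) + Real.sin t * q.eval (Real.cos t)

lemma TrigDeg.mono {a b : ℕ} {g : ℝ → ℝ} (h : TrigDeg a g) (hab : a ≤ b) : TrigDeg b g := by
  obtain ⟨p, q, h1, h2, h3, h4⟩ := h
  exact ⟨p, q, h1.trans hab, h2.trans hab, h3.trans hab, h4⟩

lemma TrigDeg.const (c : ℝ) : TrigDeg 0 (fun _ => c) :=
  ⟨Polynomial.C c, 0, by simp, by simp, by simp, by simp⟩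

lemma TrigDeg.linear (a b : ℝ) : TrigDeg 1 (fun t => Real.cos t * a + Real.sin t * b) := by
  have h : ∀ c : ℝ, (Polynomial.C c * Polynomial.X).natDegree ≤ 1 := fun c =>
    (Polynomial.natDegree_C_mul_le _ _).trans Polynomial.natDegree_X_le
  refine ⟨Polynomial.C a * Polynomial.X, Polynomial.C b, h a, by simp, ?_, fun t => ?_⟩
  · rw [mul_comm]; exact h b
  · rw [Polynomial.eval_mul, Polynomial.eval_C, Polynomial.eval_X, Polynomial.eval_C]; ring

lemma TrigDeg.add {d : ℕ} {g h : ℝ → ℝ} (hg : TrigDeg d g) (hh : TrigDeg d h) :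
    TrigDeg d (fun t => g t + h t) := by
  obtain ⟨p, q, h1, h2, h3, h4⟩ := hg
  obtain ⟨p', q', h1', h2', h3', h4'⟩ := hh
  refine ⟨p + p', q + q', Polynomial.natDegree_add_le_of_degree_le h1 h1',
    Polynomial.natDegree_add_le_of_degree_le h2 h2', ?_, fun t => ?_⟩
  · rw [mul_add]; exact Polynomial.natDegree_add_le_of_degree_le h3 h3'
  · simp only [h4, h4', Polynomial.eval_add]; ring

lemma TrigDeg.mul {a b : ℕ} {g h : ℝ → ℝ} (hg : TrigDeg a g) (hh : TrigDeg b h) :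
    TrigDeg (a + b) (fun t => g t * h t) := by
  obtain ⟨p, q, h1, h2, h3, h4⟩ := hg
  obtain ⟨p', q', h1', h2', h3', h4'⟩ := hh
  refine ⟨p * p' + (q * q' - (Polynomial.X * q) * (Polynomial.X * q')), p * q' + q * p',
    ?_, ?_, ?_, fun t => ?_⟩
  · refine Polynomial.natDegree_add_le_of_degree_le (Polynomial.natDegree_mul_le_of_le h1 h1')
      ((Polynomial.natDegree_sub_le _ _).trans (max_le (Polynomial.natDegree_mul_le_of_le h2 h2')
        (Polynomial.natDegree_mul_le_of_le h3 h3')))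
  · exact Polynomial.natDegree_add_le_of_degree_le (Polynomial.natDegree_mul_le_of_le h1 h2')
      (Polynomial.natDegree_mul_le_of_le h2 h1')
  · rw [show Polynomial.X * (p * q' + q * p') = p * (Polynomial.X * q') + (Polynomial.X * q) * p' by
      ring]
    exact Polynomial.natDegree_add_le_of_degree_le (Polynomial.natDegree_mul_le_of_le h1 h3')
      (Polynomial.natDegree_mul_le_of_le h3 h1')
  · simp only [h4, h4', Polynomial.eval_add, Polynomial.eval_sub, Polynomial.eval_mul,
      Polynomial.eval_X]
    linear_combination (Polynomial.eval (Real.cos t) q * Polynomial.eval (Real.cos t) q') *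
      (Real.sin_sq_add_cos_sq t)

lemma TrigDeg.pow {a : ℕ} {g : ℝ → ℝ} (hg : TrigDeg a g) (k : ℕ) :
    TrigDeg (k * a) (fun t => g t ^ k) := by
  induction k with
  | zero => simpa using TrigDeg.const 1
  | succ k ih =>
    have := ih.mul hg
    simpa [pow_succ, add_mul] using this

lemma TrigDeg.prod {ι : Type*} (s : Finset ι) (e : ι → ℕ) (g : ι → ℝ → ℝ)
    (h : ∀ i, TrigDeg (e i) (g i)) : TrigDeg (∑ i ∈ s, e i) (fun t => ∏ i ∈ s, g i t) := by
  classical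
  induction s using Finset.induction_on with
  | empty => simpa using TrigDeg.const 1
  | insert i s hi ih =>
    simp only [Finset.sum_insert hi, Finset.prod_insert hi]
    exact (h i).mul ih

lemma TrigDeg.sum {ι : Type*} (s : Finset ι) (d : ℕ) (g : ι → ℝ → ℝ)
    (h : ∀ i ∈ s, TrigDeg d (g i)) : TrigDeg d (fun t => ∑ i ∈ s, g i t) := by
  classical
  induction s using Finset.induction_on with
  | empty => simpa using (TrigDeg.const 0).mono (Nat.zero_le d)
  | insert i s hi ih =>
    simp only [Finset.sum_insert hi]
    exact (h i (by simp)).add (ih fun j hj => h j (by simp [hj]))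

lemma trigDeg_eval {m d : ℕ} (p : MvPolynomial (Fin m) ℝ) (hp : p.IsHomogeneous d)
    (x v : Fin m → ℝ) :
    TrigDeg d (fun t => eval (fun j => Real.cos t * x j + Real.sin t * v j) p) := by
  simp only [MvPolynomial.eval_eq]
  refine TrigDeg.sum _ _ _ fun e he => ?_
  have hdeg : ∑ i ∈ e.support, e i * 1 = d := by
    have := hp (MvPolynomial.mem_support_iff.1 he)
    rw [← this]
    simp [Finsupp.weight_apply, Finsupp.sum]
  have h1 := TrigDeg.prod e.support (fun i => e i * 1)
    (fun i t => (Real.cos t * x i + Real.sin t * v i) ^ e i)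
    (fun i => (TrigDeg.linear (x i) (v i)).pow (e i))
  rw [hdeg] at h1
  simpa using (TrigDeg.const (coeff e p)).mul h1

lemma markov_one {d : ℕ} {p : Polynomial ℝ} (hp : p.natDegree ≤ d) {M : ℝ} (hM : 0 < M)
    (hb : ∀ t, |p.eval (Real.cos t)| ≤ M) : p.derivative.eval 1 ≤ (d : ℝ) ^ 2 * M := by
  have h := Polynomial.Chebyshev.eval_iterate_derivative_le_of_forall_abs_le_one (n := d)
    (P := Polynomial.C M⁻¹ * p) (k := 1) (x := 1) le_rfl
    (Polynomial.degree_le_of_natDegree_le ((Polynomial.natDegree_C_mul_le _ _).trans hp)) (by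
      intro x hx
      have := hb (Real.arccos x)
      rw [Real.cos_arccos hx.1 hx.2] at this
      rw [Polynomial.eval_mul, Polynomial.eval_C, abs_mul, abs_of_pos (inv_pos.2 hM),
        inv_mul_le_iff₀ hM]
      simpa using this)
  simp only [Function.iterate_one, Polynomial.Chebyshev.T_derivative_eq_U,
    Polynomial.derivative_C_mul, Polynomial.eval_mul, Polynomial.eval_C,
    Polynomial.Chebyshev.U_eval_one] at h
  rw [inv_mul_le_iff₀ hM] at h
  refine h.trans (le_of_eq ?_)
  simp
  ring

/-- Second derivative bound. -/
lemma second_deriv {d : ℕ} {g : ℝ → ℝ} (hg : TrigDeg d g) {M : ℝ} (hM : 0 < M)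
    (hb : ∀ t, |g t| ≤ M) : -((d : ℝ) ^ 2 * M) ≤ deriv (deriv g) 0 := by
  obtain ⟨p, q, h1, -, -, h4⟩ := hg
  have hp := markov_one h1 hM (fun t => by
    have a := abs_le.1 (hb t)
    have b := abs_le.1 (hb (-t))
    simp only [h4, Real.cos_neg, Real.sin_neg] at a b
    rw [abs_le]; constructor <;> linarith [a.1, a.2, b.1, b.2])
  have hc : ∀ (r : Polynomial ℝ) (t : ℝ), HasDerivAt (fun t => r.eval (Real.cos t))
      (r.derivative.eval (Real.cos t) * (-Real.sin t)) t := fun r t =>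
    (r.hasDerivAt (Real.cos t)).comp t (Real.hasDerivAt_cos t)
  have e1 : deriv g = fun t => p.derivative.eval (Real.cos t) * (-Real.sin t) +
      (Real.cos t * q.eval (Real.cos t) +
        Real.sin t * (q.derivative.eval (Real.cos t) * (-Real.sin t))) := by
    ext t
    have : g = fun t => p.eval (Real.cos t) + Real.sin t * q.eval (Real.cos t) := funext h4
    rw [this]
    exact ((hc p t).add ((Real.hasDerivAt_sin t).mul (hc q t))).deriv
  have e2 := ((hc p.derivative 0).mul (Real.hasDerivAt_sin 0).neg).add
    (((Real.hasDerivAt_cos 0).mul (hc q 0)).add ((Real.hasDerivAt_sin 0).mul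
      ((hc q.derivative 0).mul (Real.hasDerivAt_sin 0).neg)))
  rw [e1]
  have e3 := e2.deriv
  simp only [Real.sin_zero, Real.cos_zero] at e3
  refine le_trans (b := -(p.derivative.eval 1)) (by linarith) (le_of_eq ?_)
  refine Eq.trans ?_ e3.symm
  simp

lemma taylor_bound {g : ℝ → ℝ} (hg : Differentiable ℝ g) (hg' : Differentiable ℝ (deriv g))
    {K : ℝ} (h0 : deriv g 0 = 0) (h2 : ∀ s, -K ≤ deriv (deriv g) s) {t : ℝ} (ht : 0 ≤ t) :
    g 0 - K * t ^ 2 / 2 ≤ g t := by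
  have m1 : Monotone (fun s => deriv g s + K * s) := by
    refine monotone_of_hasDerivAt_nonneg (f' := fun s => deriv (deriv g) s + K * 1)
      (fun s => ((hg' s).hasDerivAt).add ((hasDerivAt_id s).const_mul K)) ?_
    intro s; have := h2 s; simp; linarith
  have hd : ∀ s, HasDerivAt (fun s => g s + K * s ^ 2 / 2) (deriv g s + K * s) s := by
    intro s
    have := ((hg s).hasDerivAt).add ((((hasDerivAt_id s).pow 2).const_mul K).div_const 2)
    refine this.congr_deriv ?_
    simp; ring
  have m2 : MonotoneOn (fun s => g s + K * s ^ 2 / 2) (Set.Ici 0) := by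
    refine monotoneOn_of_deriv_nonneg (convex_Ici 0)
      (fun s _ => (hd s).continuousAt.continuousWithinAt)
      (fun s _ => (hd s).differentiableAt.differentiableWithinAt) ?_
    intro s hs
    rw [interior_Ici] at hs
    rw [(hd s).deriv]
    have := m1 (le_of_lt hs)
    simpa [h0] using this
  have := m2 (Set.mem_Ici.2 le_rfl) (Set.mem_Ici.2 ht) ht
  simp at this
  linarith

lemma great_circle {m d : ℕ} (p : MvPolynomial (Fin m) ℝ) (hp : p.IsHomogeneous d)
    {M : ℝ} (hM : 0 < M) (hb : ∀ z : Fin m → ℝ, ∑ j, z j ^ 2 = 1 → |eval z p| ≤ M)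
    (x v : Fin m → ℝ) (hx : ∑ j, x j ^ 2 = 1) (hv : ∑ j, v j ^ 2 = 1) (hxv : ∑ j, x j * v j = 0)
    (hpx : eval x p = M) {t : ℝ} (ht : 0 ≤ t) :
    M - (d : ℝ) ^ 2 * M * t ^ 2 / 2 ≤
      eval (fun j => Real.cos t * x j + Real.sin t * v j) p := by
  set g : ℝ → ℝ := fun t => eval (fun j => Real.cos t * x j + Real.sin t * v j) p with hgdef
  have hcirc : ∀ t, ∑ j, (Real.cos t * x j + Real.sin t * v j) ^ 2 = 1 := by
    intro t
    have : ∀ j, (Real.cos t * x j + Real.sin t * v j) ^ 2 = Real.cos t ^ 2 * x j ^ 2 +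
      (2 * Real.cos t * Real.sin t) * (x j * v j) + Real.sin t ^ 2 * v j ^ 2 := fun j => by ring
    simp only [this, Finset.sum_add_distrib, ← Finset.mul_sum, hx, hv, hxv]
    linarith [Real.sin_sq_add_cos_sq t]
  have hgb : ∀ t, |g t| ≤ M := fun t => hb _ (hcirc t)
  have hg0 : g 0 = M := by simp [hgdef, hpx]
  have hT := trigDeg_eval p hp x v
  have hsm : ContDiff ℝ 2 g := by
    simp only [hgdef, MvPolynomial.eval_eq]
    fun_prop
  have hdiff : Differentiable ℝ g := hsm.differentiable (by norm_num)
  have hdiff' : Differentiable ℝ (deriv g) :=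
    ((contDiff_succ_iff_deriv (n := 1)).1 hsm).2.2.differentiable (by norm_num)
  have h0 : deriv g 0 = 0 := by
    apply IsLocalMax.deriv_eq_zero
    refine Filter.Eventually.of_forall fun t => ?_
    rw [hg0]; exact (abs_le.1 (hgb t)).2
  have h2 : ∀ s, -((d : ℝ) ^ 2 * M) ≤ deriv (deriv g) s := by
    intro s
    have hT := trigDeg_eval p hp (fun j => Real.cos s * x j + Real.sin s * v j)
      (fun j => -Real.sin s * x j + Real.cos s * v j)
    have he : (fun t => eval (fun j => Real.cos t * (Real.cos s * x j + Real.sin s * v j) +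
        Real.sin t * (-Real.sin s * x j + Real.cos s * v j)) p) = fun t => g (t + s) := by
      ext t
      simp only [hgdef, Real.cos_add, Real.sin_add]
      congr 2
      ext j; ring
    rw [he] at hT
    have := second_deriv hT hM (fun t => hgb (t + s))
    have e1 : deriv (fun t => g (t + s)) = fun t => deriv g (t + s) := by
      ext t; exact deriv_comp_add_const g s t
    rw [e1, deriv_comp_add_const (deriv g) s 0] at this
    simpa using this
  have := taylor_bound hdiff hdiff' h0 h2 ht
  rwa [hg0] at this

lemma near_max {m d : ℕ} (p : MvPolynomial (Fin m) ℝ) (hp : p.IsHomogeneous d)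
    {M : ℝ} (hM : 0 < M) (hb : ∀ z : Fin m → ℝ, ∑ j, z j ^ 2 = 1 → |eval z p| ≤ M)
    (x y : Fin m → ℝ) (hx : ∑ j, x j ^ 2 = 1) (hy : ∑ j, y j ^ 2 = 1)
    (hpx : eval x p = M) (hpi : Real.arccos (∑ j, x j * y j) < Real.pi) :
    M - (d : ℝ) ^ 2 * M * Real.arccos (∑ j, x j * y j) ^ 2 / 2 ≤ eval y p := by
  set c := ∑ j, x j * y j with hc
  set θ := Real.arccos c with hθ
  have hcs : c ^ 2 ≤ 1 := by
    have := Finset.sum_mul_sq_le_sq_mul_sq Finset.univ x y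
    rw [hx, hy] at this; simpa using this
  have hcos : Real.cos θ = c := Real.cos_arccos (by nlinarith) (by nlinarith)
  have h0 : 0 ≤ θ := Real.arccos_nonneg _
  have hexp : ∀ a b : ℝ, ∑ j, (a * y j + b * x j) ^ 2 = a ^ 2 + 2 * a * b * c + b ^ 2 := by
    intro a b
    have : ∀ j, (a * y j + b * x j) ^ 2 = a ^ 2 * y j ^ 2 +
      (2 * a * b) * (x j * y j) + b ^ 2 * x j ^ 2 := fun j => by ring
    simp only [this, Finset.sum_add_distrib, ← Finset.mul_sum, hx, hy, ← hc]
    ring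
  rcases h0.eq_or_lt with h | h
  · have hc1 : c = 1 := by rw [← hcos, ← h, Real.cos_zero]
    have hyx : y = x := by
      have := hexp 1 (-1)
      rw [hc1] at this
      norm_num at this
      rw [Finset.sum_eq_zero_iff_of_nonneg (fun _ _ => sq_nonneg _)] at this
      ext j
      have := this j (Finset.mem_univ j)
      have := pow_eq_zero_iff (two_ne_zero) |>.1 this
      linarith
    rw [← h, hyx, hpx]; simp
  · have hs : 0 < Real.sin θ := Real.sin_pos_of_pos_of_lt_pi h hpi
    have hs2 : Real.sin θ ^ 2 = 1 - c ^ 2 := by rw [Real.sin_sq, hcos]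
    have key := great_circle p hp hM hb x
      (fun j => (Real.sin θ)⁻¹ * y j + (-(Real.sin θ)⁻¹ * c) * x j) hx (by
        rw [hexp]
        field_simp
        rw [hs2]; ring) (by
        have : ∀ j, x j * ((Real.sin θ)⁻¹ * y j + (-(Real.sin θ)⁻¹ * c) * x j) =
          (Real.sin θ)⁻¹ * (x j * y j) + (-(Real.sin θ)⁻¹ * c) * x j ^ 2 := fun j => by ring
        simp only [this, Finset.sum_add_distrib, ← Finset.mul_sum, hx, ← hc]
        ring) hpx h0
    convert key using 3
    ext j
    rw [hcos]
    field_simp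
    ring

lemma vnorm_eq_one {m : ℕ} (v : Fin m → ℝ) : vnorm v = 1 ↔ ∑ j, v j ^ 2 = 1 := by
  rw [vnorm, Real.sqrt_eq_one]

lemma sphere_compact (m : ℕ) : IsCompact {v : Fin m → ℝ | ∑ j, v j ^ 2 = 1} := by
  refine (isCompact_univ_pi (fun _ : Fin m => isCompact_Icc (a := (-1 : ℝ)) (b := 1))).of_isClosed_subset
    (isClosed_eq (by fun_prop) continuous_const) ?_
  intro v hv j _
  have : v j ^ 2 ≤ 1 := by
    rw [← (show ∑ j, v j ^ 2 = 1 from hv)]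
    exact Finset.single_le_sum (f := fun j => v j ^ 2) (fun i _ => sq_nonneg _) (Finset.mem_univ j)
  exact ⟨by nlinarith, by nlinarith⟩

/-- Net estimate for one polynomial. -/
lemma one_poly {m d D : ℕ} (hd : 1 ≤ d) (hdD : d ≤ D) (p : MvPolynomial (Fin m) ℝ)
    (hp : p.IsHomogeneous d) (δ : ℝ) (hδ : (D : ℝ) * δ < Real.sqrt 2)
    (G : Finset (Fin m → ℝ)) (hGs : ∀ y ∈ G, vnorm y = 1)
    (hGnet : ∀ x : Fin m → ℝ, vnorm x = 1 → ∃ y ∈ G, Real.arccos (∑ j, x j * y j) < δ)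
    (z : Fin m → ℝ) (hz : vnorm z = 1) :
    ∃ y ∈ G, (1 - (D : ℝ) ^ 2 * δ ^ 2 / 2) * |eval z p| ≤ |eval y p| := by
  have hz' := (vnorm_eq_one z).1 hz
  obtain ⟨x, hx, hmax⟩ := (sphere_compact m).exists_isMaxOn ⟨z, hz'⟩
    (f := fun z => |eval z p|) (MvPolynomial.continuous_eval p).abs.continuousOn
  obtain ⟨y, hyG, hy⟩ := hGnet x ((vnorm_eq_one x).2 hx)
  refine ⟨y, hyG, ?_⟩
  have hy1 := (vnorm_eq_one y).1 (hGs y hyG)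
  have hθ := Real.arccos_nonneg (∑ j, x j * y j)
  have hδ0 : 0 < δ := hθ.trans_lt hy
  have hD1 : (1 : ℝ) ≤ D := by exact_mod_cast hd.trans hdD
  have hdD' : (d : ℝ) ≤ D := by exact_mod_cast hdD
  have hsq : Real.sqrt 2 < 2 := by
    rw [Real.sqrt_lt' (by norm_num)]; norm_num
  have hDδ : (D : ℝ) ^ 2 * δ ^ 2 < 2 := by
    rw [← mul_pow]
    have := Real.sq_sqrt (show (0 : ℝ) ≤ 2 by norm_num)
    have : 0 < D * δ := by positivity
    nlinarith [Real.sqrt_nonneg 2]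
  have hpi : Real.arccos (∑ j, x j * y j) < Real.pi := by
    have := Real.pi_gt_three
    nlinarith
  have hb : ∀ z : Fin m → ℝ, ∑ j, z j ^ 2 = 1 → |eval z p| ≤ |eval x p| := fun z hz => hmax hz
  have hC : 0 < 1 - (D : ℝ) ^ 2 * δ ^ 2 / 2 := by linarith
  rcases (abs_nonneg (eval x p)).eq_or_lt with h | h
  · have := hb z hz'
    rw [← h] at this
    have := le_antisymm this (abs_nonneg _)
    rw [this]; simp
  have hle : (1 - (D : ℝ) ^ 2 * δ ^ 2 / 2) * |eval z p| ≤ |eval x p| -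
      (d : ℝ) ^ 2 * |eval x p| * Real.arccos (∑ j, x j * y j) ^ 2 / 2 := by
    have h1 : (d : ℝ) ^ 2 * Real.arccos (∑ j, x j * y j) ^ 2 ≤ (D : ℝ) ^ 2 * δ ^ 2 := by gcongr
    have h2 := mul_le_mul_of_nonneg_left (hb z hz') hC.le
    nlinarith
  refine hle.trans ?_
  rcases abs_choice (eval x p) with hs | hs
  · exact (near_max p hp h hb x y hx hy1 hs.symm hpi).trans (le_abs_self _)
  · have := near_max (-p) (hp.neg) h (by simpa using hb) x y hx hy1 (by simpa using hs.symm) hpi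
    refine this.trans ?_
    rw [map_neg]; exact neg_le_abs _

/-- Proposition 4.3: if `G` is a spherical `δ`-net and `Dδ < √2`, then the maximum of
`max_i |f_i|` over `G` approximates `‖f‖∞` up to the factor `(1 - D²δ²/2)⁻¹`. -/
theorem supNorm_grid_estimate (n q : ℕ) (hn : 1 ≤ n) (hq : 1 ≤ q)
    (d : Fin q → ℕ) (hd : ∀ i, 1 ≤ d i) (D : ℕ) (hD : D = Finset.univ.sup d)
    (f : Fin q → MvPolynomial (Fin (n + 1)) ℝ) (hf : ∀ i, (f i).IsHomogeneous (d i))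
    (δ : ℝ) (G : Finset (Fin (n + 1) → ℝ)) (hGs : ∀ y ∈ G, vnorm y = 1)
    (hGnet : ∀ x : Fin (n + 1) → ℝ, vnorm x = 1 →
      ∃ y ∈ G, Real.arccos (∑ j, x j * y j) < δ)
    (hδ : (D : ℝ) * δ < Real.sqrt 2) :
    gridMax G f ≤ polySupNorm f ∧
    polySupNorm f ≤ (1 - (D : ℝ) ^ 2 * δ ^ 2 / 2)⁻¹ * gridMax G f := by
  classical
  have hbdd : ∀ i, ∃ B : ℝ, ∀ x : Fin (n + 1) → ℝ, vnorm x = 1 → |eval x (f i)| ≤ B := by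
    intro i
    obtain ⟨B, hB⟩ := (sphere_compact (n + 1)).bddAbove_image
      (f := fun z => |eval z (f i)|) (MvPolynomial.continuous_eval (f i)).abs.continuousOn
    exact ⟨B, fun x hx => hB ⟨x, (vnorm_eq_one x).1 hx, rfl⟩⟩
  choose B hB using hbdd
  have hB0 : 0 ≤ ∑ i, |B i| := Finset.sum_nonneg fun _ _ => abs_nonneg _
  have hgfin : BddAbove {t : ℝ | ∃ x ∈ G, ∃ i : Fin q, t = |eval x (f i)|} := by
    refine ⟨∑ i, |B i|, ?_⟩
    rintro t ⟨x, hx, i, rfl⟩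
    exact ((hB i x (hGs x hx)).trans (le_abs_self _)).trans
      (Finset.single_le_sum (f := fun i => |B i|) (fun _ _ => abs_nonneg _) (Finset.mem_univ i))
  have hgn : 0 ≤ gridMax G f := by
    apply Real.sSup_nonneg
    rintro t ⟨x, hx, i, rfl⟩
    exact abs_nonneg _
  have hpn : 0 ≤ polySupNorm f :=
    Real.iSup_nonneg fun x => Real.iSup_nonneg fun i => abs_nonneg _
  constructor
  · refine Real.sSup_le ?_ hpn
    rintro t ⟨x, hx, i, rfl⟩
    have h1 : |eval x (f i)| ≤ ⨆ i : Fin q, |eval x (f i)| :=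
      le_ciSup (f := fun i : Fin q => |eval x (f i)|) (Set.finite_range _).bddAbove i
    refine h1.trans ?_
    refine le_ciSup (f := fun x : {x : Fin (n + 1) → ℝ // vnorm x = 1} =>
      ⨆ i : Fin q, |eval x.1 (f i)|) ?_ ⟨x, hGs x hx⟩
    refine ⟨∑ i, |B i|, ?_⟩
    rintro _ ⟨z, rfl⟩
    refine Real.iSup_le (fun i => ?_) hB0
    exact ((hB i z.1 z.2).trans (le_abs_self _)).trans
      (Finset.single_le_sum (f := fun i => |B i|) (fun _ _ => abs_nonneg _) (Finset.mem_univ i))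
  · have hC : 0 < 1 - (D : ℝ) ^ 2 * δ ^ 2 / 2 := by
      obtain ⟨y, -, hy⟩ := hGnet (Pi.single 0 1) (by
        rw [vnorm_eq_one]; simp [Pi.single_apply])
      have hδ0 : 0 < δ := (Real.arccos_nonneg _).trans_lt hy
      have h0 : 0 ≤ (D : ℝ) * δ := by positivity
      have h2 := Real.sq_sqrt (show (0 : ℝ) ≤ 2 by norm_num)
      have : (D * δ) ^ 2 < 2 := by nlinarith [Real.sqrt_nonneg 2]
      rw [mul_pow] at this
      linarith
    have hR : 0 ≤ (1 - (D : ℝ) ^ 2 * δ ^ 2 / 2)⁻¹ * gridMax G f :=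
      mul_nonneg (inv_nonneg.2 hC.le) hgn
    refine Real.iSup_le (fun z => Real.iSup_le (fun i => ?_) hR) hR
    have hdD : d i ≤ D := by rw [hD]; exact Finset.le_sup (Finset.mem_univ i)
    obtain ⟨y, hy, h⟩ := one_poly (hd i) hdD (f i) (hf i) δ hδ G hGs hGnet z.1 z.2
    rw [le_inv_mul_iff₀ hC]
    exact h.trans (le_csSup hgfin ⟨y, hy, i, rfl⟩)
end

section
/- Let q ≤ n, let f ∈ H_d^ℝ[q] be nonzero, and let G ⊆ S^n be a δ-net (a finite set such that every x ∈ S^n has geodesic distance less than δ to some point of G). If δ·D·max_{x∈G} K(f,x) < 1, then max_{x∈G} K(f,x) ≤ K(f) ≤ (1 − δ·D·max_{x∈G} K(f,x))^{-1} · max_{x∈G} K(f,x), where D := max_i dᵢ. -/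
open MvPolynomial

/-- The smallest singular value `σ_q(Δ⁻¹Dₓg)` of the scaled derivative of `g` at `x`
restricted to the tangent space `TₓSⁿ = x^⊥`. -/
noncomputable def sigmaMin {n q : ℕ} (d : Fin q → ℕ) (x : Fin (n + 1) → ℝ)
    (g : Fin q → MvPolynomial (Fin (n + 1)) ℝ) : ℝ :=
  ⨅ u : {u : Fin q → ℝ // vnorm u = 1},
    ⨆ w : {w : Fin (n + 1) → ℝ // vnorm w ≤ 1 ∧ ∑ j, w j * x j = 0},
      |∑ i, u.1 i * ((d i : ℝ)⁻¹ * ∑ j, w.1 j * eval x (pderiv j (g i)))|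

/-- `Φₓ(g) = max{‖g(x)‖₂, σ_q(Δ⁻¹Dₓg)}`. -/
noncomputable def Phi {n q : ℕ} (d : Fin q → ℕ) (x : Fin (n + 1) → ℝ)
    (g : Fin q → MvPolynomial (Fin (n + 1)) ℝ) : ℝ :=
  max (vnorm fun i => eval x (g i)) (sigmaMin d x g)

/-- The local condition number `K(f,x) = √q ‖f‖∞ / Φₓ(f)` (value `∞` at singular points). -/
noncomputable def Kloc {n q : ℕ} (d : Fin q → ℕ) (x : Fin (n + 1) → ℝ)
    (f : Fin q → MvPolynomial (Fin (n + 1)) ℝ) : ENNReal :=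
  ENNReal.ofReal (Real.sqrt q * polySupNorm f) / ENNReal.ofReal (Phi d x f)

/-- The global condition number `K(f) = sup_{y ∈ Sⁿ} K(f,y)`. -/
noncomputable def Kglob {n q : ℕ} (d : Fin q → ℕ)
    (f : Fin q → MvPolynomial (Fin (n + 1)) ℝ) : ENNReal :=
  ⨆ y : {y : Fin (n + 1) → ℝ // vnorm y = 1}, Kloc d y.1 f

/-- `max_{x ∈ G} K(f,x)` over a finite grid `G`. -/
noncomputable def gridMaxK {n q : ℕ} (d : Fin q → ℕ) (G : Finset (Fin (n + 1) → ℝ))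
    (f : Fin q → MvPolynomial (Fin (n + 1)) ℝ) : ENNReal :=
  sSup {t : ENNReal | ∃ x ∈ G, t = Kloc d x f}


lemma riesz_sum (n : ℕ) (hn : 1 ≤ n) (z : ℕ → ℂ)
    (hz : z = fun k : ℕ => Complex.exp (Complex.I * (Real.pi * (2 * k + 1) / (2 * n) : ℝ))) (m : ℤ) (hm : |m| < 2 * n) :
    ∑ k ∈ Finset.range (2 * n), z k ^ m = if m = 0 then (2 * n : ℂ) else 0 := by
  have hn0 : (n : ℂ) ≠ 0 := by exact_mod_cast (by omega : n ≠ 0)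
  split_ifs with h
  · subst h; simp
  · set ω : ℂ := Complex.exp (2 * Real.pi * Complex.I / (2 * n : ℕ)) with hω
    have hprim : IsPrimitiveRoot ω (2 * n) := Complex.isPrimitiveRoot_exp (2 * n) (by omega)
    set θ : ℂ := Complex.exp (Complex.I * (Real.pi / (2 * n))) with hθ
    have hzk : ∀ k, z k ^ m = θ ^ m * (ω ^ m) ^ k := by
      intro k
      have : z k = θ * ω ^ k := by
        rw [hz, hθ, hω]
        simp only
        rw [← Complex.exp_nat_mul, ← Complex.exp_add]
        congr 1
        push_cast
        field_simp
        ring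
      rw [this, mul_zpow, ← zpow_natCast, ← zpow_natCast, zpow_comm]
    simp_rw [hzk]
    rw [← Finset.mul_sum]
    have h1 : ω ^ m ≠ 1 := by
      intro h1
      rw [hprim.zpow_eq_one_iff_dvd] at h1
      have := Int.eq_zero_of_abs_lt_dvd h1 (by push_cast; exact hm)
      exact h this
    have h2 : (ω ^ m) ^ (2 * n) = 1 := by
      rw [← zpow_natCast, zpow_comm, zpow_natCast, hprim.pow_eq_one, one_zpow]
    rw [geom_sum_eq h1, h2]; simp

lemma riesz (n : ℕ) (hn : 1 ≤ n) : ∃ (a : ℕ → ℝ) (z : ℕ → ℂ), (∀ k, 0 ≤ a k) ∧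
    (∀ k, ‖z k‖ = 1) ∧ ∀ l : ℕ, l ≤ 2 * n →
      ∑ k ∈ Finset.range (2 * n), (a k : ℂ) * z k ^ l = n - l := by
  have hn0 : (n : ℂ) ≠ 0 := by exact_mod_cast (by omega : n ≠ 0)
  obtain ⟨z, hz⟩ : ∃ z : ℕ → ℂ, z = fun k : ℕ => Complex.exp (Complex.I * (Real.pi * (2 * k + 1) / (2 * n) : ℝ)) := ⟨_, rfl⟩
  have hz1 : ∀ k, ‖z k‖ = 1 := by
    intro k; rw [hz]; simp only; rw [mul_comm]; exact Complex.norm_exp_ofReal_mul_I _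
  have hz0 : ∀ k, z k ≠ 0 := by
    intro k h; have := hz1 k; rw [h] at this; simp at this
  have hconj : ∀ k, (starRingEnd ℂ) (z k) = (z k)⁻¹ := by
    intro k; rw [Complex.inv_def, Complex.normSq_eq_norm_sq, hz1]; simp
  have hz2n : ∀ k, z k ^ (2 * n) = -1 := by
    intro k
    rw [hz]; simp only
    rw [← Complex.exp_nat_mul]
    have : ((2 * n : ℕ) : ℂ) * (Complex.I * ((Real.pi * (2 * k + 1) / (2 * n) : ℝ) : ℂ)) = Real.pi * Complex.I + k * (2 * Real.pi * Complex.I) := by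
      push_cast; field_simp; ring
    rw [this, Complex.exp_add, Complex.exp_nat_mul, Complex.exp_two_pi_mul_I, Complex.exp_pi_mul_I]; simp
  let a : ℕ → ℝ := fun k => (1 / (2 * n)) * Complex.normSq (∑ p ∈ Finset.range n, z k ^ p)
  have ha : ∀ k, (a k : ℂ) = (1 / (2 * n)) * ∑ p ∈ Finset.range n, ∑ r ∈ Finset.range n, z k ^ ((p : ℤ) - r) := by
    intro k
    simp only [a]
    push_cast
    rw [Complex.normSq_eq_conj_mul_self, mul_comm ((starRingEnd ℂ) _), map_sum, Finset.sum_mul_sum]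
    congr 1
    refine Finset.sum_congr rfl fun p _ => Finset.sum_congr rfl fun r _ => ?_
    rw [map_pow, hconj, zpow_sub₀ (hz0 k)]
    simp [div_eq_mul_inv]
  have key : ∀ l : ℕ, l ≤ n → ∑ k ∈ Finset.range (2 * n), (a k : ℂ) * z k ^ l = n - l := by
    intro l hl
    have : ∀ k, (a k : ℂ) * z k ^ l = (1 / (2 * n)) * ∑ p ∈ Finset.range n, ∑ r ∈ Finset.range n, z k ^ ((p : ℤ) - r + l) := by
      intro k
      rw [ha, mul_assoc, Finset.sum_mul]
      congr 1
      refine Finset.sum_congr rfl fun p _ => ?_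
      rw [Finset.sum_mul]
      refine Finset.sum_congr rfl fun r _ => ?_
      rw [zpow_add₀ (hz0 k), zpow_natCast]
    simp_rw [this]
    rw [← Finset.mul_sum, Finset.sum_comm]
    have h2 : ∀ p ∈ Finset.range n, ∑ k ∈ Finset.range (2 * n), ∑ r ∈ Finset.range n, z k ^ ((p : ℤ) - r + l) = if p < n - l then (2 * n : ℂ) else 0 := by
      intro p hp
      rw [Finset.mem_range] at hp
      rw [Finset.sum_comm]
      have h3 : ∀ r ∈ Finset.range n, ∑ k ∈ Finset.range (2 * n), z k ^ ((p : ℤ) - r + l) = if r = p + l then (2 * n : ℂ) else 0 := by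
        intro r hr
        rw [Finset.mem_range] at hr
        rw [riesz_sum n hn z hz _ (by rw [abs_lt]; omega)]
        congr 1
        apply propext; omega
      rw [Finset.sum_congr rfl h3, Finset.sum_ite_eq']
      simp only [Finset.mem_range]
      congr 1
      apply propext; omega
    rw [Finset.sum_congr rfl h2, ← Finset.sum_filter, Finset.sum_const]
    have : (Finset.range n).filter (fun p => p < n - l) = Finset.range (n - l) := by
      ext p; simp; omega
    rw [this, Finset.card_range, nsmul_eq_mul, Nat.cast_sub hl]
    field_simp
  refine ⟨a, z, fun k => mul_nonneg (by positivity) (Complex.normSq_nonneg _), hz1, fun l hl => ?_⟩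
  by_cases h : l ≤ n
  · exact key l h
  · have h1 := key (2 * n - l) (by omega)
    have h2 := congrArg (starRingEnd ℂ) h1
    rw [map_sum] at h2
    have h3 : ∀ k, (starRingEnd ℂ) ((a k : ℂ) * z k ^ (2 * n - l)) = - ((a k : ℂ) * z k ^ l) := by
      intro k
      rw [map_mul, Complex.conj_ofReal, map_pow, hconj, inv_pow]
      have : z k ^ (2 * n - l) * z k ^ l = -1 := by
        rw [← pow_add, Nat.sub_add_cancel hl, hz2n]
      have h4 : (z k ^ (2 * n - l))⁻¹ = - z k ^ l := by
        apply inv_eq_of_mul_eq_one_right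
        linear_combination -this
      rw [h4]; ring
    simp_rw [h3] at h2
    rw [Finset.sum_neg_distrib] at h2
    simp only [map_sub, Complex.conj_natCast] at h2
    rw [Nat.cast_sub hl] at h2
    push_cast at h2
    linear_combination -h2

/-- Bernstein's inequality. -/
lemma bernstein_ineq (n : ℕ) (hn : 1 ≤ n) (P : Polynomial ℂ) (hP : P.natDegree ≤ 2 * n) (M : ℝ)
    (hM : ∀ t : ℝ, ‖P.eval (Complex.exp (t * Complex.I))‖ ≤ M) :
    ‖P.derivative.eval 1 - n * P.eval 1‖ ≤ n * M := by
  obtain ⟨a, z, ha, hz, h⟩ := riesz n hn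
  have hM' : ∀ k, ‖P.eval (z k)‖ ≤ M := by
    intro k
    have := hM (Complex.arg (z k))
    have h2 := Complex.norm_mul_exp_arg_mul_I (z k)
    rw [hz k] at h2
    simp only [Complex.ofReal_one, one_mul] at h2
    rwa [h2] at this
  have e : ∑ k ∈ Finset.range (2 * n), (a k : ℂ) * P.eval (z k) = n * P.eval 1 - P.derivative.eval 1 := by
    have hd : P.derivative.eval 1 = ∑ l ∈ Finset.range (2 * n + 1), P.coeff l * l := by
      rw [Polynomial.derivative_eval, Polynomial.sum_over_range' _ (by simp) (2 * n + 1) (by omega)]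
      simp
    have hE : ∀ w, P.eval w = ∑ l ∈ Finset.range (2 * n + 1), P.coeff l * w ^ l := fun w =>
      Polynomial.eval_eq_sum_range' (by omega) w
    rw [hd]
    simp_rw [hE, Finset.mul_sum]
    rw [Finset.sum_comm, ← Finset.sum_sub_distrib]
    refine Finset.sum_congr rfl fun l hl => ?_
    rw [Finset.mem_range] at hl
    have := h l (by omega)
    calc _ = P.coeff l * ∑ k ∈ Finset.range (2 * n), (a k : ℂ) * z k ^ l := by
          rw [Finset.mul_sum]; exact Finset.sum_congr rfl fun _ _ => by ring
      _ = _ := by rw [this]; ring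
  have hs : ∑ k ∈ Finset.range (2 * n), a k = n := by
    have := h 0 (by omega)
    simp at this
    exact_mod_cast this
  rw [norm_sub_rev, ← e]
  calc _ ≤ ∑ k ∈ Finset.range (2 * n), ‖(a k : ℂ) * P.eval (z k)‖ := norm_sum_le _ _
    _ ≤ ∑ k ∈ Finset.range (2 * n), a k * M := by
        refine Finset.sum_le_sum fun k _ => ?_
        rw [norm_mul, Complex.norm_real, Real.norm_of_nonneg (ha k)]
        exact mul_le_mul_of_nonneg_left (hM' k) (ha k)
    _ = _ := by rw [← Finset.sum_mul, hs]
lemma aeval_mul_hom {m d : ℕ} {A : Type*} [CommRing A] [Algebra ℝ A] {f : MvPolynomial (Fin m) ℝ}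
    (hf : f.IsHomogeneous d) (c : A) (g : Fin m → A) :
    aeval (fun j => c * g j) f = c ^ d * aeval g f := by
  rw [aeval_def, aeval_def, eval₂_eq', eval₂_eq', Finset.mul_sum]
  refine Finset.sum_congr rfl fun s hs => ?_
  simp_rw [mul_pow]
  rw [Finset.prod_mul_distrib, Finset.prod_pow_eq_pow_sum]
  have : ∑ i, s i = d := by
    have := hf (mem_support_iff.1 hs)
    rw [← this, Finsupp.weight_apply, Finsupp.sum_fintype] <;> simp
  rw [this]; ring

lemma aeval_ofReal {m : ℕ} (f : MvPolynomial (Fin m) ℝ) (x : Fin m → ℝ) :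
    aeval (fun j => (x j : ℂ)) f = ((eval x f : ℝ) : ℂ) := by
  have := MvPolynomial.aeval_algebraMap_apply (A := ℝ) ℂ x f
  simpa [aeval_eq_eval, Function.comp_def] using this

lemma derivative_aeval {m : ℕ} (f : MvPolynomial (Fin m) ℝ) (g : Fin m → Polynomial ℂ) :
    Polynomial.derivative (aeval g f) = ∑ j, aeval g (pderiv j f) * Polynomial.derivative (g j) := by
  induction f using MvPolynomial.induction_on with
  | C a =>
    simp [IsScalarTower.algebraMap_apply ℝ ℂ (Polynomial ℂ)]
  | add p q hp hq =>
    simp only [map_add, hp, hq, add_mul, Finset.sum_add_distrib]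
  | mul_X p i hp =>
    rw [map_mul, aeval_X, Polynomial.derivative_mul, hp]
    simp only [Derivation.leibniz, smul_eq_mul, map_add, map_mul, aeval_X, pderiv_X, add_mul, Finset.sum_add_distrib]
    rw [add_comm]
    congr 1
    · simp [Pi.single_apply, apply_ite, ite_mul]
    · rw [Finset.sum_mul]
      exact Finset.sum_congr rfl fun j _ => by ring

lemma hasDerivAt_eval {m : ℕ} (f : MvPolynomial (Fin m) ℝ) (γ γ' : ℝ → Fin m → ℝ) (t : ℝ)
    (h : ∀ j, HasDerivAt (fun s => γ s j) (γ' t j) t) :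
    HasDerivAt (fun s => eval (γ s) f) (∑ j, γ' t j * eval (γ t) (pderiv j f)) t := by
  induction f using MvPolynomial.induction_on with
  | C a => simpa using hasDerivAt_const t a
  | add p q hp hq =>
    simp only [map_add, mul_add, Finset.sum_add_distrib]
    exact hp.add hq
  | mul_X p i hp =>
    simp only [map_mul, eval_X]
    refine (hp.mul (h i)).congr_deriv ?_
    symm
    simp only [Derivation.leibniz, smul_eq_mul, map_add, map_mul, eval_X, pderiv_X, mul_add, Finset.sum_add_distrib]
    rw [add_comm]
    congr 1
    · rw [Finset.sum_mul]
      exact Finset.sum_congr rfl fun j _ => by ring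
    · simp [Pi.single_apply, apply_ite, mul_comm]

noncomputable def Lin {m : ℕ} (x w : Fin m → ℝ) (j : Fin m) : Polynomial ℂ :=
  Polynomial.C ((x j : ℂ) / 2) * (Polynomial.X ^ 2 + 1) +
    Polynomial.C (-Complex.I * w j / 2) * (Polynomial.X ^ 2 - 1)

lemma Lin_natDegree {m : ℕ} (x w : Fin m → ℝ) (j : Fin m) : (Lin x w j).natDegree ≤ 2 := by
  unfold Lin; compute_degree

lemma Lin_eval {m : ℕ} (x w : Fin m → ℝ) (j : Fin m) (t : ℝ) :
    (Lin x w j).eval (Complex.exp (t * Complex.I)) =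
      Complex.exp (t * Complex.I) * ((Real.cos t * x j + Real.sin t * w j : ℝ) : ℂ) := by
  unfold Lin
  rw [Complex.exp_mul_I]
  have h := Complex.sin_sq_add_cos_sq (t : ℂ)
  simp
  linear_combination ((x j : ℂ) / 2 * (-1) - Complex.I * w j / 2 ) * h + (-(w j : ℂ) * Complex.sin t * Complex.cos t + x j / 2 * (Complex.sin t)^2 - Complex.I * w j / 2 * (Complex.sin t)^2 ) * Complex.I_sq

noncomputable def Dir {m : ℕ} (f : MvPolynomial (Fin m) ℝ) (x w : Fin m → ℝ) : ℝ :=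
  ∑ j, w j * eval x (pderiv j f)

lemma natDegree_aeval_Lin {m d : ℕ} {f : MvPolynomial (Fin m) ℝ} (hf : f.IsHomogeneous d) (x w : Fin m → ℝ) :
    (aeval (Lin x w) f).natDegree ≤ 2 * d := by
  rw [aeval_def, eval₂_eq']
  refine Polynomial.natDegree_sum_le_of_forall_le _ _ fun s hs => ?_
  have : ∑ i, s i = d := by
    have := hf (mem_support_iff.1 hs)
    rw [← this, Finsupp.weight_apply, Finsupp.sum_fintype] <;> simp
  rw [IsScalarTower.algebraMap_apply ℝ ℂ (Polynomial ℂ)]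
  refine (Polynomial.natDegree_C_mul_le _ _).trans ?_
  refine (Polynomial.natDegree_prod_le _ _).trans ?_
  rw [← this, Finset.mul_sum]
  refine Finset.sum_le_sum fun i _ => ?_
  refine Polynomial.natDegree_pow_le.trans ?_
  rw [mul_comm]
  exact Nat.mul_le_mul_right _ (Lin_natDegree x w i)

lemma eval_aeval_Lin {m d : ℕ} {f : MvPolynomial (Fin m) ℝ} (hf : f.IsHomogeneous d) (x w : Fin m → ℝ) (t : ℝ) :
    (aeval (Lin x w) f).eval (Complex.exp (t * Complex.I)) =
      Complex.exp (t * Complex.I) ^ d * ((eval (Real.cos t • x + Real.sin t • w) f : ℝ) : ℂ) := by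
  have h1 : ∀ z : ℂ, (aeval (Lin x w) f).eval z = aeval (fun j => (Lin x w j).eval z) f := by
    intro z
    have := MvPolynomial.comp_aeval_apply (R := ℝ) (Lin x w) ((Polynomial.aeval z : Polynomial ℂ →ₐ[ℂ] ℂ).restrictScalars ℝ) f
    simpa [Polynomial.coe_aeval_eq_eval] using this
  rw [h1]
  simp_rw [Lin_eval]
  rw [aeval_mul_hom hf, aeval_ofReal]
  rfl

lemma deriv_aeval_Lin {m d : ℕ} {f : MvPolynomial (Fin m) ℝ} (hf : f.IsHomogeneous d) (x w : Fin m → ℝ) :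
    (Polynomial.derivative (aeval (Lin x w) f)).eval 1 - d * (aeval (Lin x w) f).eval 1 = -Complex.I * (Dir f x w : ℂ) := by
  have h1 : ∀ g : MvPolynomial (Fin m) ℝ, (aeval (Lin x w) g).eval 1 = ((eval x g : ℝ) : ℂ) := by
    intro g
    have := MvPolynomial.comp_aeval_apply (R := ℝ) (Lin x w) ((Polynomial.aeval (1 : ℂ) : Polynomial ℂ →ₐ[ℂ] ℂ).restrictScalars ℝ) g
    rw [← aeval_ofReal]
    have h2 : (fun j => (x j : ℂ)) = fun j => (Lin x w j).eval 1 := by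
      funext j; simp [Lin]; ring
    rw [h2]
    simpa [Polynomial.coe_aeval_eq_eval] using this
  have h3 : ∀ j, (Polynomial.derivative (Lin x w j)).eval 1 = x j - Complex.I * w j := by
    intro j; simp [Lin]; ring
  have hE := congrArg (eval x) hf.sum_X_mul_pderiv
  rw [map_sum] at hE
  simp only [map_mul, eval_X, nsmul_eq_mul, map_natCast] at hE
  rw [derivative_aeval, Polynomial.eval_finsetSum]
  simp_rw [Polynomial.eval_mul, h1, h3]
  have hE' := congrArg (fun r : ℝ => (r : ℂ)) hE
  push_cast at hE'
  rw [← hE']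
  unfold Dir
  push_cast
  rw [Finset.mul_sum, ← Finset.sum_sub_distrib]
  exact Finset.sum_congr rfl fun j _ => by ring

/-- difference Bernstein -/
lemma dir_sub_le {m d : ℕ} (hd : 1 ≤ d) {f : MvPolynomial (Fin m) ℝ} (hf : f.IsHomogeneous d)
    (x w y v : Fin m → ℝ) (M : ℝ)
    (hM : ∀ t : ℝ, |eval (Real.cos t • y + Real.sin t • v) f - eval (Real.cos t • x + Real.sin t • w) f| ≤ M) :
    |Dir f y v - Dir f x w| ≤ d * M := by
  have := bernstein_ineq d hd (aeval (Lin y v) f - aeval (Lin x w) f)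
    ((Polynomial.natDegree_sub_le _ _).trans (max_le (natDegree_aeval_Lin hf y v) (natDegree_aeval_Lin hf x w))) M (by
      intro t
      rw [Polynomial.eval_sub, eval_aeval_Lin hf, eval_aeval_Lin hf, ← mul_sub, norm_mul, norm_pow, Complex.norm_exp_ofReal_mul_I, one_pow, one_mul, ← Complex.ofReal_sub, Complex.norm_real]
      exact hM t)
  have e : (Polynomial.derivative (aeval (Lin y v) f - aeval (Lin x w) f)).eval 1 - d * (aeval (Lin y v) f - aeval (Lin x w) f).eval 1 = -Complex.I * ((Dir f y v - Dir f x w : ℝ) : ℂ) := by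
    have h1 := deriv_aeval_Lin hf x w
    have h2 := deriv_aeval_Lin hf y v
    simp only [map_sub, Polynomial.eval_sub]
    push_cast
    linear_combination h2 - h1
  rw [e, norm_mul, norm_neg, Complex.norm_I, one_mul, Complex.norm_real] at this
  exact this

lemma dir_le {m d : ℕ} (hd : 1 ≤ d) {f : MvPolynomial (Fin m) ℝ} (hf : f.IsHomogeneous d)
    (x w : Fin m → ℝ) (M : ℝ)
    (hM : ∀ t : ℝ, |eval (Real.cos t • x + Real.sin t • w) f| ≤ M) :
    |Dir f x w| ≤ d * M := by
  have h0 : eval (0 : Fin m → ℝ) f = 0 := by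
    have := aeval_mul_hom hf (0 : ℝ) (0 : Fin m → ℝ)
    simp only [zero_mul, zero_pow (by omega : d ≠ 0)] at this
    simpa [aeval_eq_eval] using this
  have := dir_sub_le hd hf 0 0 x w M (by intro t; rw [smul_zero, smul_zero, add_zero, h0, sub_zero]; exact hM t)
  simpa [Dir] using this

lemma dsn {m : ℕ} (x : Fin m → ℝ) : 0 ≤ x ⬝ᵥ x := Finset.sum_nonneg fun i _ => mul_self_nonneg _

lemma vnorm_sq_eq {m : ℕ} (x : Fin m → ℝ) : vnorm x = Real.sqrt (x ⬝ᵥ x) := by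
  unfold vnorm dotProduct; simp_rw [pow_two]

lemma vnorm_one_iff {m : ℕ} (x : Fin m → ℝ) : vnorm x = 1 ↔ x ⬝ᵥ x = 1 := by
  rw [vnorm_sq_eq, Real.sqrt_eq_one]

lemma vnorm_le_one_iff {m : ℕ} (x : Fin m → ℝ) : vnorm x ≤ 1 ↔ x ⬝ᵥ x ≤ 1 := by
  rw [vnorm_sq_eq, Real.sqrt_le_one]

lemma unit_comb {m : ℕ} {x w : Fin m → ℝ} (hx : x ⬝ᵥ x = 1) (hw : w ⬝ᵥ w = 1) (h : x ⬝ᵥ w = 0) (t : ℝ) :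
    (Real.cos t • x + Real.sin t • w) ⬝ᵥ (Real.cos t • x + Real.sin t • w) = 1 := by
  simp only [dotProduct_add, add_dotProduct, dotProduct_smul, smul_dotProduct, smul_eq_mul, hx, hw, h, dotProduct_comm w x]
  linear_combination Real.sin_sq_add_cos_sq t

lemma dot_sub_self {m : ℕ} {x y : Fin m → ℝ} (hx : x ⬝ᵥ x = 1) (hy : y ⬝ᵥ y = 1) :
    (y - x) ⬝ᵥ (y - x) = 2 - 2 * (x ⬝ᵥ y) := by
  simp only [dotProduct_sub, sub_dotProduct, hx, hy, dotProduct_comm y x]; ring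

lemma dot_add_self {m : ℕ} {x y : Fin m → ℝ} (hx : x ⬝ᵥ x = 1) (hy : y ⬝ᵥ y = 1) :
    (y + x) ⬝ᵥ (y + x) = 2 + 2 * (x ⬝ᵥ y) := by
  simp only [dotProduct_add, add_dotProduct, hx, hy, dotProduct_comm y x]; ring

lemma dot_cases {m : ℕ} {x y : Fin m → ℝ} (hx : x ⬝ᵥ x = 1) (hy : y ⬝ᵥ y = 1) :
    y = x ∨ y = -x ∨ (-1 < x ⬝ᵥ y ∧ x ⬝ᵥ y < 1) := by
  have h1 := dsn (y - x)
  have h2 := dsn (y + x)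
  have e1 := dot_sub_self hx hy
  have e2 := dot_add_self hx hy
  by_cases h : y = x
  · exact Or.inl h
  by_cases h' : y = -x
  · exact Or.inr (Or.inl h')
  refine Or.inr (Or.inr ⟨?_, ?_⟩)
  · rcases h2.lt_or_eq with h3 | h3
    · linarith
    · exact absurd (eq_neg_of_add_eq_zero_left (dotProduct_self_eq_zero.1 h3.symm)) h'
  · rcases h1.lt_or_eq with h3 | h3
    · linarith
    · exact absurd (sub_eq_zero.1 (dotProduct_self_eq_zero.1 h3.symm)) h

lemma lip {m d : ℕ} (hd : 1 ≤ d) {f : MvPolynomial (Fin m) ℝ} (hf : f.IsHomogeneous d) (M : ℝ)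
    (hM : ∀ x, x ⬝ᵥ x = 1 → |eval x f| ≤ M) {x y : Fin m → ℝ} (hx : x ⬝ᵥ x = 1) (hy : y ⬝ᵥ y = 1) :
    |eval y f - eval x f| ≤ d * M * Real.arccos (x ⬝ᵥ y) := by
  have hM0 : 0 ≤ M := (abs_nonneg _).trans (hM x hx)
  have hd1 : (1 : ℝ) ≤ d := by exact_mod_cast hd
  rcases dot_cases hx hy with h | h | ⟨h1, h2⟩
  · subst h
    rw [sub_self, abs_zero]
    have := Real.arccos_nonneg (y ⬝ᵥ y)
    positivity
  · have : x ⬝ᵥ y = -1 := by rw [h, dotProduct_neg, hx]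
    rw [this, Real.arccos_neg_one]
    have a1 := hM x hx
    have a2 := hM y hy
    have a3 := abs_sub (eval y f) (eval x f)
    have a4 := Real.pi_gt_three
    have a5 : M ≤ d * M := by nlinarith
    nlinarith
  · set c := x ⬝ᵥ y with hc
    set θ := Real.arccos c with hθ
    have hcos : Real.cos θ = c := Real.cos_arccos h1.le h2.le
    have hθ0 : 0 ≤ θ := Real.arccos_nonneg c
    have hsin : Real.sin θ ^ 2 = 1 - c ^ 2 := by rw [← hcos]; linarith [Real.sin_sq_add_cos_sq θ]
    have hs0 : Real.sin θ ≠ 0 := by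
      intro h; rw [h] at hsin; nlinarith
    set s := Real.sin θ
    let w : Fin m → ℝ := s⁻¹ • (y - c • x)
    have hxw : x ⬝ᵥ w = 0 := by
      simp only [w, dotProduct_smul, dotProduct_sub, smul_eq_mul, hx, ← hc]; ring
    have hww : w ⬝ᵥ w = 1 := by
      simp only [w, dotProduct_smul, dotProduct_sub, smul_dotProduct, sub_dotProduct, smul_eq_mul, hx, hy, dotProduct_comm y x, ← hc]
      field_simp
      linear_combination -hsin
    have hyw : y = Real.cos θ • x + s • w := by
      simp only [w, smul_smul, mul_inv_cancel₀ hs0, one_smul, hcos]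
      abel
    let γ : ℝ → Fin m → ℝ := fun t => Real.cos t • x + Real.sin t • w
    let γ' : ℝ → Fin m → ℝ := fun t => (-Real.sin t) • x + Real.cos t • w
    have hγ : ∀ t, γ t ⬝ᵥ γ t = 1 := fun t => unit_comb hx hww hxw t
    have hγ' : ∀ t, γ' t ⬝ᵥ γ' t = 1 := fun t => by
      simp only [γ', dotProduct_add, add_dotProduct, dotProduct_smul, smul_dotProduct, smul_eq_mul, hx, hww, hxw, dotProduct_comm w x]
      linear_combination Real.sin_sq_add_cos_sq t
    have hγγ' : ∀ t, γ t ⬝ᵥ γ' t = 0 := fun t => by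
      simp only [γ, γ', dotProduct_add, add_dotProduct, dotProduct_smul, smul_dotProduct, smul_eq_mul, hx, hww, hxw, dotProduct_comm w x]
      ring
    have hder : ∀ t, HasDerivAt (fun r => eval (γ r) f) (Dir f (γ t) (γ' t)) t := by
      intro t
      refine hasDerivAt_eval f γ γ' t fun j => ?_
      exact ((Real.hasDerivAt_cos t).mul_const (x j)).add ((Real.hasDerivAt_sin t).mul_const (w j))
    have hb : ∀ t, |Dir f (γ t) (γ' t)| ≤ d * M := fun t =>
      dir_le hd hf _ _ M fun r => hM _ (unit_comb (hγ t) (hγ' t) (hγγ' t) r)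
    have := norm_image_sub_le_of_norm_deriv_le_segment' (f := fun r => eval (γ r) f) (a := 0) (b := θ) (C := d * M)
      (fun t _ => (hder t).hasDerivWithinAt) (fun t _ => hb t) θ ⟨hθ0, le_rfl⟩
    have g0 : γ 0 = x := by simp [γ]
    have g1 : γ θ = y := hyw.symm
    simp only [g0, g1, sub_zero] at this
    exact this

lemma exists_rot {m : ℕ} {x y : Fin m → ℝ} (hx : x ⬝ᵥ x = 1) (hy : y ⬝ᵥ y = 1) :
    ∃ R : (Fin m → ℝ) →ₗ[ℝ] (Fin m → ℝ), R x = y ∧ (∀ z, R z ⬝ᵥ R z = z ⬝ᵥ z) ∧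
      ∀ z, z ⬝ᵥ z = 1 → x ⬝ᵥ y ≤ z ⬝ᵥ R z := by
  rcases dot_cases hx hy with h | h | ⟨h1, h2⟩
  · exact ⟨LinearMap.id, h.symm, fun z => rfl, fun z hz => by rw [h]; simp [hx, hz]⟩
  · exact ⟨-LinearMap.id, by simp [h], fun z => by simp, fun z hz => by rw [h]; simp [hx, hz]⟩
  · set c := x ⬝ᵥ y with hc
    have hc1 : 1 + c ≠ 0 := by linarith
    let R : (Fin m → ℝ) →ₗ[ℝ] (Fin m → ℝ) :=
      { toFun := fun z => z - (((x ⬝ᵥ z + y ⬝ᵥ z) / (1 + c)) • (x + y)) + (2 * (x ⬝ᵥ z)) • y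
        map_add' := by
          intro a b
          ext j
          simp only [dotProduct_add, Pi.add_apply, Pi.sub_apply, Pi.smul_apply, smul_eq_mul]
          ring
        map_smul' := by
          intro a b
          ext j
          simp only [dotProduct_smul, Pi.add_apply, Pi.sub_apply, Pi.smul_apply, smul_eq_mul, RingHom.id_apply]
          ring }
    have hR : ∀ z, R z = z - (((x ⬝ᵥ z + y ⬝ᵥ z) / (1 + c)) • (x + y)) + (2 * (x ⬝ᵥ z)) • y := fun z => rfl
    refine ⟨R, ?_, ?_, ?_⟩
    · rw [hR, hx, dotProduct_comm y x, ← hc, div_self hc1]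
      ext j; simp; ring
    · intro z
      rw [hR]
      simp only [dotProduct_add, add_dotProduct, dotProduct_sub, sub_dotProduct, dotProduct_smul, smul_dotProduct, smul_eq_mul, hx, hy, dotProduct_comm y x, dotProduct_comm z x, dotProduct_comm z y, ← hc]
      field_simp
      ring
    · intro z hz
      have hg := dsn ((1 - c ^ 2) • z - (x ⬝ᵥ z - (y ⬝ᵥ z) * c) • x - (y ⬝ᵥ z - (x ⬝ᵥ z) * c) • y)
      rw [hR]
      simp only [dotProduct_add, add_dotProduct, dotProduct_sub, sub_dotProduct, dotProduct_smul, smul_dotProduct, smul_eq_mul, hx, hy, hz, dotProduct_comm y x, dotProduct_comm z x, dotProduct_comm z y, ← hc] at hg ⊢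
      set a := x ⬝ᵥ z
      set b := y ⬝ᵥ z
      have hpos : 0 < 1 - c ^ 2 := by nlinarith
      have hG : 0 ≤ 1 - a ^ 2 - b ^ 2 - c ^ 2 + 2 * a * b * c := by
        refine nonneg_of_mul_nonneg_right (b := 1 - a ^ 2 - b ^ 2 - c ^ 2 + 2 * a * b * c) (a := 1 - c ^ 2) ?_ hpos
        linarith
      have hc2 : 0 < 1 + c := by linarith
      have e : 1 - (a + b) / (1 + c) * (a + b) + 2 * a * b - c = (1 - a ^ 2 - b ^ 2 - c ^ 2 + 2 * a * b * c) / (1 + c) := by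
        field_simp; ring
      have := div_nonneg hG hc2.le
      linarith

lemma rot_dot {m : ℕ} (R : (Fin m → ℝ) →ₗ[ℝ] (Fin m → ℝ)) (h : ∀ z, R z ⬝ᵥ R z = z ⬝ᵥ z) (a b : Fin m → ℝ) :
    R a ⬝ᵥ R b = a ⬝ᵥ b := by
  have h1 := h (a + b)
  rw [map_add] at h1
  simp only [dotProduct_add, add_dotProduct, h, dotProduct_comm (R b) (R a), dotProduct_comm b a] at h1
  linarith

lemma Dir_smul {m : ℕ} (f : MvPolynomial (Fin m) ℝ) (x w : Fin m → ℝ) (r : ℝ) : Dir f x (r • w) = r * Dir f x w := by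
  unfold Dir
  rw [Finset.mul_sum]
  exact Finset.sum_congr rfl fun j _ => by simp; ring

lemma dir_rot {m d : ℕ} (hd : 1 ≤ d) {f : MvPolynomial (Fin m) ℝ} (hf : f.IsHomogeneous d) (M : ℝ)
    (hM : ∀ x, x ⬝ᵥ x = 1 → |eval x f| ≤ M) {x y : Fin m → ℝ} (hx : x ⬝ᵥ x = 1)
    (R : (Fin m → ℝ) →ₗ[ℝ] (Fin m → ℝ)) (hRx : R x = y) (hR : ∀ z, R z ⬝ᵥ R z = z ⬝ᵥ z)
    (hRz : ∀ z, z ⬝ᵥ z = 1 → x ⬝ᵥ y ≤ z ⬝ᵥ R z) (w : Fin m → ℝ) (hw : w ⬝ᵥ w ≤ 1) (hwx : x ⬝ᵥ w = 0) :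
    |Dir f y (R w) - Dir f x w| ≤ d * (d * M * Real.arccos (x ⬝ᵥ y)) := by
  have hM0 : 0 ≤ M := (abs_nonneg _).trans (hM x hx)
  have hB : 0 ≤ d * (d * M * Real.arccos (x ⬝ᵥ y)) := by
    have := Real.arccos_nonneg (x ⬝ᵥ y)
    positivity
  have unitc : ∀ v : Fin m → ℝ, v ⬝ᵥ v = 1 → x ⬝ᵥ v = 0 → |Dir f y (R v) - Dir f x v| ≤ d * (d * M * Real.arccos (x ⬝ᵥ y)) := by
    intro v hv hxv
    refine dir_sub_le hd hf x v y (R v) _ fun t => ?_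
    have hz := unit_comb hx hv hxv t
    have e : Real.cos t • y + Real.sin t • R v = R (Real.cos t • x + Real.sin t • v) := by
      rw [map_add, map_smul, map_smul, hRx]
    rw [e]
    refine (lip hd hf M hM hz (by rw [hR, hz])).trans ?_
    exact mul_le_mul_of_nonneg_left (Real.arccos_le_arccos (hRz _ hz)) (by positivity)
  rcases (dsn w).lt_or_eq with h | h
  · set r := Real.sqrt (w ⬝ᵥ w) with hr
    have hr0 : 0 < r := Real.sqrt_pos.2 h
    have hr2 : r ^ 2 = w ⬝ᵥ w := Real.sq_sqrt h.le
    have hr1 : r ≤ 1 := Real.sqrt_le_one.2 hw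
    have hu := unitc (r⁻¹ • w) (by
      simp only [dotProduct_smul, smul_dotProduct, smul_eq_mul, ← hr2]; field_simp) (by simp [dotProduct_smul, hwx])
    rw [map_smul, Dir_smul, Dir_smul, ← mul_sub, abs_mul, abs_of_pos (inv_pos.2 hr0)] at hu
    have : |Dir f y (R w) - Dir f x w| = r * (r⁻¹ * |Dir f y (R w) - Dir f x w|) := by
      field_simp
    rw [this]
    calc _ ≤ r * (d * (d * M * Real.arccos (x ⬝ᵥ y))) := mul_le_mul_of_nonneg_left hu hr0.le
      _ ≤ 1 * (d * (d * M * Real.arccos (x ⬝ᵥ y))) := mul_le_mul_of_nonneg_right hr1 hB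
      _ = _ := one_mul _
  · have : w = 0 := dotProduct_self_eq_zero.1 h.symm
    subst this
    simpa [Dir] using hB

lemma le_polySupNorm {n q : ℕ} (f : Fin q → MvPolynomial (Fin (n + 1)) ℝ) (i : Fin q) (x : Fin (n + 1) → ℝ)
    (hx : x ⬝ᵥ x = 1) : |eval x (f i)| ≤ polySupNorm f := by
  have hcomp : IsCompact {x : Fin (n + 1) → ℝ | vnorm x = 1} := by
    refine Metric.isCompact_of_isClosed_isBounded ?_ ?_
    · refine isClosed_eq ?_ continuous_const
      unfold vnorm
      fun_prop
    · refine (Metric.isBounded_closedBall (x := (0 : Fin (n + 1) → ℝ)) (r := 1)).subset ?_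
      intro x hx
      rw [mem_closedBall_zero_iff, pi_norm_le_iff_of_nonneg zero_le_one]
      intro j
      have h1 : x ⬝ᵥ x = 1 := (vnorm_one_iff x).1 hx
      have h2 : x j * x j ≤ x ⬝ᵥ x :=
        Finset.single_le_sum (f := fun j => x j * x j) (fun k _ => mul_self_nonneg _) (Finset.mem_univ j)
      rw [Real.norm_eq_abs]
      exact abs_le_one_iff_mul_self_le_one.2 (h1 ▸ h2)
  have hcont : Continuous fun x : Fin (n + 1) → ℝ => ∑ i, |eval x (f i)| := by
    refine continuous_finsetSum _ fun i _ => ?_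
    exact (MvPolynomial.continuous_eval (f i)).abs
  obtain ⟨B, hB⟩ := hcomp.bddAbove_image hcont.continuousOn
  have hbdd : BddAbove (Set.range fun x : {x : Fin (n + 1) → ℝ // vnorm x = 1} => ⨆ i : Fin q, |eval x.1 (f i)|) := by
    refine ⟨B, ?_⟩
    rintro _ ⟨x, rfl⟩
    have h1 : ∑ i, |eval x.1 (f i)| ≤ B := hB ⟨x.1, x.2, rfl⟩
    have : Nonempty (Fin q) := ⟨i⟩
    refine ciSup_le fun i => le_trans ?_ h1
    exact Finset.single_le_sum (f := fun i => |eval x.1 (f i)|) (fun k _ => abs_nonneg _) (Finset.mem_univ i)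
  unfold polySupNorm
  refine le_trans ?_ (le_ciSup hbdd ⟨x, (vnorm_one_iff x).2 hx⟩)
  exact le_ciSup (f := fun i => |eval x (f i)|) (Set.finite_range _).bddAbove i

lemma polySupNorm_nonneg {n q : ℕ} (f : Fin q → MvPolynomial (Fin (n + 1)) ℝ) : 0 ≤ polySupNorm f :=
  Real.iSup_nonneg fun _ => Real.iSup_nonneg fun _ => abs_nonneg _

lemma vnorm_eq_norm {m : ℕ} (v : Fin m → ℝ) : vnorm v = ‖WithLp.toLp 2 v‖ := by
  rw [EuclideanSpace.norm_eq]; simp [vnorm]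

lemma vnorm_le_add {m : ℕ} (a b : Fin m → ℝ) : vnorm a ≤ vnorm b + vnorm (a - b) := by
  simp only [vnorm_eq_norm, WithLp.toLp_sub]
  exact norm_le_norm_add_norm_sub' _ _

lemma vnorm_le_of {m : ℕ} (a : Fin m → ℝ) (B : ℝ) (hB : 0 ≤ B) (h : ∀ i, |a i| ≤ B) : vnorm a ≤ Real.sqrt m * B := by
  unfold vnorm
  rw [Real.sqrt_le_left (by positivity), mul_pow, Real.sq_sqrt (by positivity)]
  calc _ ≤ ∑ _j : Fin m, B ^ 2 := Finset.sum_le_sum fun j _ => sq_le_sq' (by linarith [abs_le.1 (h j)]) (abs_le.1 (h j)).2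
    _ = _ := by simp

lemma sum_abs_le {m : ℕ} (u : Fin m → ℝ) (h : vnorm u = 1) : ∑ i, |u i| ≤ Real.sqrt m := by
  have h1 : ∑ i, u i ^ 2 = 1 := by simpa [vnorm] using h
  apply Real.le_sqrt_of_sq_le
  have := sq_sum_le_card_mul_sum_sq (s := Finset.univ) (f := fun i => |u i|)
  simpa [h1] using this

lemma sigma_lip {n q : ℕ} (hq : 1 ≤ q)
    (d : Fin q → ℕ) (hd : ∀ i, 1 ≤ d i) (D : ℕ) (hD : D = Finset.univ.sup d)
    (f : Fin q → MvPolynomial (Fin (n + 1)) ℝ) (hf : ∀ i, (f i).IsHomogeneous (d i))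
    {x y : Fin (n + 1) → ℝ} (hx : x ⬝ᵥ x = 1) (hy : y ⬝ᵥ y = 1) :
    sigmaMin d x f ≤ sigmaMin d y f + Real.sqrt q * (D * polySupNorm f * Real.arccos (x ⬝ᵥ y)) := by
  obtain ⟨R, hRx, hR, hRz⟩ := exists_rot hx hy
  set M := polySupNorm f
  have hM0 : 0 ≤ M := polySupNorm_nonneg f
  set θ := Real.arccos (x ⬝ᵥ y)
  have hθ : 0 ≤ θ := Real.arccos_nonneg _
  have hdD : ∀ i, (d i : ℝ) ≤ D := fun i => by
    rw [hD]; exact_mod_cast Finset.le_sup (f := d) (Finset.mem_univ i)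
  unfold sigmaMin
  have hne : Nonempty {u : Fin q → ℝ // vnorm u = 1} :=
    ⟨⟨Pi.single ⟨0, hq⟩ 1, by rw [vnorm_one_iff]; simp⟩⟩
  rw [← sub_le_iff_le_add]
  refine le_ciInf fun u => ?_
  rw [sub_le_iff_le_add]
  have hbb : BddBelow (Set.range fun u : {u : Fin q → ℝ // vnorm u = 1} =>
    ⨆ w : {w : Fin (n + 1) → ℝ // vnorm w ≤ 1 ∧ ∑ j, w j * x j = 0},
      |∑ i, u.1 i * ((d i : ℝ)⁻¹ * ∑ j, w.1 j * eval x (pderiv j (f i)))|) := by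
    refine ⟨0, ?_⟩
    rintro _ ⟨u, rfl⟩
    exact Real.iSup_nonneg fun _ => abs_nonneg _
  refine (ciInf_le hbb u).trans ?_
  have : Nonempty {w : Fin (n + 1) → ℝ // vnorm w ≤ 1 ∧ ∑ j, w j * x j = 0} :=
    ⟨⟨0, by rw [vnorm_le_one_iff]; simp⟩⟩
  refine ciSup_le fun w => ?_
  have hw1 : w.1 ⬝ᵥ w.1 ≤ 1 := (vnorm_le_one_iff _).1 w.2.1
  have hw2 : w.1 ⬝ᵥ x = 0 := w.2.2
  have hba : BddAbove (Set.range fun w : {w : Fin (n + 1) → ℝ // vnorm w ≤ 1 ∧ ∑ j, w j * y j = 0} =>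
      |∑ i, u.1 i * ((d i : ℝ)⁻¹ * ∑ j, w.1 j * eval y (pderiv j (f i)))|) := by
    refine ⟨∑ i, |u.1 i| * (|(d i : ℝ)⁻¹| * ∑ j, |eval y (pderiv j (f i))|), ?_⟩
    rintro _ ⟨w, rfl⟩
    refine (Finset.abs_sum_le_sum_abs _ _).trans (Finset.sum_le_sum fun i _ => ?_)
    rw [abs_mul, abs_mul]
    refine mul_le_mul_of_nonneg_left (mul_le_mul_of_nonneg_left ?_ (abs_nonneg _)) (abs_nonneg _)
    refine (Finset.abs_sum_le_sum_abs _ _).trans (Finset.sum_le_sum fun j _ => ?_)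
    rw [abs_mul]
    have h1 : w.1 ⬝ᵥ w.1 ≤ 1 := (vnorm_le_one_iff _).1 w.2.1
    have h2 : w.1 j * w.1 j ≤ w.1 ⬝ᵥ w.1 :=
        Finset.single_le_sum (f := fun j => w.1 j * w.1 j) (fun k _ => mul_self_nonneg _) (Finset.mem_univ j)
    exact mul_le_of_le_one_left (abs_nonneg _) (abs_le_one_iff_mul_self_le_one.2 (h2.trans h1))
  have hle := le_ciSup hba ⟨R w.1, (vnorm_le_one_iff _).2 (by rw [hR]; exact hw1), by
    change R w.1 ⬝ᵥ y = 0
    rw [← hRx, rot_dot R hR, hw2]⟩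
  refine le_trans ?_ (add_le_add_left hle _)
  simp only
  have hdiff : |(∑ i, u.1 i * ((d i : ℝ)⁻¹ * Dir (f i) y (R w.1))) - (∑ i, u.1 i * ((d i : ℝ)⁻¹ * Dir (f i) x w.1))|
      ≤ Real.sqrt q * (D * M * θ) := by
    rw [← Finset.sum_sub_distrib]
    refine (Finset.abs_sum_le_sum_abs _ _).trans ?_
    calc _ ≤ ∑ i, |u.1 i| * (D * M * θ) := by
          refine Finset.sum_le_sum fun i _ => ?_
          rw [← mul_sub, ← mul_sub, abs_mul]
          refine mul_le_mul_of_nonneg_left ?_ (abs_nonneg _)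
          have hdi : (0 : ℝ) < d i := by exact_mod_cast hd i
          rw [abs_mul, abs_of_pos (inv_pos.2 hdi)]
          have := dir_rot (hd i) (hf i) M (fun z hz => le_polySupNorm f i z hz) hx R hRx hR hRz w.1 hw1
            (by rw [dotProduct_comm]; exact hw2)
          calc _ ≤ (d i : ℝ)⁻¹ * (d i * (d i * M * θ)) := mul_le_mul_of_nonneg_left this (inv_pos.2 hdi).le
            _ = d i * M * θ := by field_simp
            _ ≤ _ := by have := hdD i; gcongr
      _ = (∑ i, |u.1 i|) * (D * M * θ) := by rw [Finset.sum_mul]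
      _ ≤ _ := mul_le_mul_of_nonneg_right (sum_abs_le _ u.2) (by positivity)
  have h3 := abs_sub_abs_le_abs_sub (∑ i, u.1 i * ((d i : ℝ)⁻¹ * Dir (f i) x w.1)) (∑ i, u.1 i * ((d i : ℝ)⁻¹ * Dir (f i) y (R w.1)))
  rw [abs_sub_comm] at h3
  unfold Dir at h3 hdiff
  linarith

lemma phi_lip {n q : ℕ} (hq : 1 ≤ q)
    (d : Fin q → ℕ) (hd : ∀ i, 1 ≤ d i) (D : ℕ) (hD : D = Finset.univ.sup d)
    (f : Fin q → MvPolynomial (Fin (n + 1)) ℝ) (hf : ∀ i, (f i).IsHomogeneous (d i))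
    {x y : Fin (n + 1) → ℝ} (hx : x ⬝ᵥ x = 1) (hy : y ⬝ᵥ y = 1) :
    Phi d x f ≤ Phi d y f + Real.sqrt q * (D * polySupNorm f * Real.arccos (x ⬝ᵥ y)) := by
  have hM0 := polySupNorm_nonneg f
  have hθ := Real.arccos_nonneg (x ⬝ᵥ y)
  have hdD : ∀ i, (d i : ℝ) ≤ D := fun i => by
    rw [hD]; exact_mod_cast Finset.le_sup (f := d) (Finset.mem_univ i)
  unfold Phi
  refine max_le ?_ ((sigma_lip hq d hd D hD f hf hx hy).trans (add_le_add_left (le_max_right _ _) _))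
  refine (vnorm_le_add _ (fun i => eval y (f i))).trans (add_le_add (le_max_left _ _) ?_)
  refine vnorm_le_of _ _ (by positivity) fun i => ?_
  rw [Pi.sub_apply, abs_sub_comm]
  refine (lip (hd i) (hf i) _ (fun z hz => le_polySupNorm f i z hz) hx hy).trans ?_
  have := hdD i
  gcongr

theorem K_grid_estimate (n q : ℕ) (hn : 1 ≤ n) (hq : 1 ≤ q) (hqn : q ≤ n)
    (d : Fin q → ℕ) (hd : ∀ i, 1 ≤ d i) (D : ℕ) (hD : D = Finset.univ.sup d)
    (f : Fin q → MvPolynomial (Fin (n + 1)) ℝ) (hf : ∀ i, (f i).IsHomogeneous (d i))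
    (hf0 : f ≠ 0)
    (δ : ℝ) (G : Finset (Fin (n + 1) → ℝ)) (hGs : ∀ y ∈ G, vnorm y = 1)
    (hGnet : ∀ x : Fin (n + 1) → ℝ, vnorm x = 1 →
      ∃ y ∈ G, Real.arccos (∑ j, x j * y j) < δ)
    (hsmall : ENNReal.ofReal (δ * D) * gridMaxK d G f < 1) :
    gridMaxK d G f ≤ Kglob d f ∧
    Kglob d f ≤ (1 - ENNReal.ofReal (δ * D) * gridMaxK d G f)⁻¹ * gridMaxK d G f := by
  constructor
  · refine sSup_le ?_
    rintro t ⟨x, hx, rfl⟩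
    exact le_iSup (fun y : {y : Fin (n + 1) → ℝ // vnorm y = 1} => Kloc d y.1 f) ⟨x, hGs x hx⟩
  · refine iSup_le fun y => ?_
    obtain ⟨x, hxG, hxδ⟩ := hGnet y.1 y.2
    have hx := (vnorm_one_iff _).1 (hGs x hxG)
    have hy := (vnorm_one_iff _).1 y.2
    set κ := gridMaxK d G f with hκ
    have hle : Kloc d x f ≤ κ := le_sSup ⟨x, hxG, rfl⟩
    have hlip := phi_lip hq d hd D hD f hf hx hy
    rw [dotProduct_comm] at hlip
    change Real.arccos (y.1 ⬝ᵥ x) < δ at hxδ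
    set θ := Real.arccos (y.1 ⬝ᵥ x)
    have hθ : 0 ≤ θ := Real.arccos_nonneg _
    have hδ : 0 < δ := hθ.trans_lt hxδ
    have hD1 : 1 ≤ D := by
      rw [hD]; exact (hd ⟨0, hq⟩).trans (Finset.le_sup (f := d) (Finset.mem_univ _))
    have hD0 : (0 : ℝ) < D := by exact_mod_cast hD1
    have hM0 := polySupNorm_nonneg f
    unfold Kloc at hle ⊢
    set A := Real.sqrt q * polySupNorm f with hA
    have hA0 : 0 ≤ A := by positivity
    rcases hA0.eq_or_lt with h0 | hApos
    · rw [← h0]; simp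
    have hδD : 0 < δ * D := by positivity
    have hκtop : κ ≠ ⊤ := by
      intro h
      rw [h, ENNReal.mul_top (by simpa using hδD)] at hsmall
      simp at hsmall
    obtain ⟨k, hk⟩ : ∃ k : ℝ, k = κ.toReal := ⟨_, rfl⟩
    have hkκ : κ = ENNReal.ofReal k := by rw [hk, ENNReal.ofReal_toReal hκtop]
    have hk0 : 0 ≤ k := hk ▸ ENNReal.toReal_nonneg
    have hPx : 0 < Phi d x f := by
      by_contra h
      rw [ENNReal.ofReal_of_nonpos (not_lt.1 h), ENNReal.div_zero (by simpa using hApos)] at hle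
      exact hκtop (top_le_iff.1 hle)
    rw [hkκ] at hle hsmall ⊢
    rw [← ENNReal.ofReal_div_of_pos hPx, ENNReal.ofReal_le_ofReal_iff hk0, div_le_iff₀ hPx] at hle
    rw [← ENNReal.ofReal_mul hδD.le, ← ENNReal.ofReal_one, ENNReal.ofReal_lt_ofReal_iff one_pos] at hsmall
    rw [← ENNReal.ofReal_mul hδD.le, ← ENNReal.ofReal_one, ← ENNReal.ofReal_sub _ (by positivity)]
    have hpos : 0 < 1 - δ * D * k := by linarith
    have hkpos : 0 < k := by
      rcases hk0.eq_or_lt with h | h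
      · rw [← h] at hle; linarith
      · exact h
    rw [← ENNReal.ofReal_inv_of_pos hpos, ← ENNReal.ofReal_mul (by positivity)]
    have hmain : A * (1 - δ * D * k) ≤ k * Phi d y.1 f := by
      have h1 : Phi d x f ≤ Phi d y.1 f + A * (D * δ) := by
        refine hlip.trans (add_le_add_right ?_ _)
        calc _ = A * (D * θ) := by rw [hA]; ring
          _ ≤ _ := by gcongr
      nlinarith [mul_le_mul_of_nonneg_left h1 hk0]
    have hPy : 0 < Phi d y.1 f := by
      have : 0 < k * Phi d y.1 f := lt_of_lt_of_le (by positivity) hmain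
      exact pos_of_mul_pos_right this hk0
    rw [← ENNReal.ofReal_div_of_pos hPy]
    apply ENNReal.ofReal_le_ofReal
    rw [div_le_iff₀ hPy, mul_assoc, ← div_eq_inv_mul, le_div_iff₀ hpos]
    exact hmain
end

section
/- Let q ≤ n, f ∈ H_d^ℝ[q] and x ∈ S^n. Define, for h ∈ H_d^ℝ[q], the norm ‖h‖_{∞,d} := max_{y∈S^n} ( ‖h(y)‖₂² + ‖Δ^{−1/2}D_yh‖² )^{1/2}, where D_yh is the derivative of h at y restricted to T_yS^n = y^⊥ and ‖·‖ is the operator norm, and let Σ_{d,x} := { g ∈ H_d^ℝ[q] : g(x) = 0 and rank Dₓg < q }. Then inf{ ‖f − g‖_{∞,d} : g ∈ Σ_{d,x} } = ( ‖f(x)‖₂² + σ_q(Δ^{−1/2}Dₓf)² )^{1/2}. -/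
open MvPolynomial

/-- The operator norm `‖Δ^{-1/2} D_y h‖` of the scaled derivative of `h` at `y`
restricted to the tangent space `T_ySⁿ = y^⊥`. -/
noncomputable def scaledDerivNorm {n q : ℕ} (d : Fin q → ℕ) (y : Fin (n + 1) → ℝ)
    (h : Fin q → MvPolynomial (Fin (n + 1)) ℝ) : ℝ :=
  ⨆ w : {w : Fin (n + 1) → ℝ // vnorm w ≤ 1 ∧ ∑ j, w j * y j = 0},
    vnorm fun i => (Real.sqrt (d i))⁻¹ * ∑ j, w.1 j * eval y (pderiv j (h i))

/-- The norm `‖h‖_{∞,d} = max_{y∈Sⁿ} √(‖h(y)‖₂² + ‖Δ^{-1/2}D_yh‖²)`. -/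
noncomputable def normInfD {n q : ℕ} (d : Fin q → ℕ)
    (h : Fin q → MvPolynomial (Fin (n + 1)) ℝ) : ℝ :=
  ⨆ y : {y : Fin (n + 1) → ℝ // vnorm y = 1},
    Real.sqrt ((vnorm fun i => eval y.1 (h i)) ^ 2 + scaledDerivNorm d y.1 h ^ 2)

/-- The smallest singular value `σ_q(Δ^{-1/2}Dₓf)` of the scaled derivative of `f` at `x`
restricted to the tangent space. -/
noncomputable def sigmaMinHalf {n q : ℕ} (d : Fin q → ℕ) (x : Fin (n + 1) → ℝ)
    (f : Fin q → MvPolynomial (Fin (n + 1)) ℝ) : ℝ :=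
  ⨅ u : {u : Fin q → ℝ // vnorm u = 1},
    ⨆ w : {w : Fin (n + 1) → ℝ // vnorm w ≤ 1 ∧ ∑ j, w j * x j = 0},
      |∑ i, u.1 i * ((Real.sqrt (d i))⁻¹ * ∑ j, w.1 j * eval x (pderiv j (f i)))|

/-- The set `Σ_{d,x}` of systems in `H_d^ℝ[q]` having `x` as a singular zero: `g(x) = 0`
and `Dₓg : x^⊥ → ℝ^q` is not of full rank `q` (equivalently, some nonzero `u ∈ ℝ^q`
annihilates its range). -/
def SingularAt {n q : ℕ} (d : Fin q → ℕ) (x : Fin (n + 1) → ℝ) :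
    Set (Fin q → MvPolynomial (Fin (n + 1)) ℝ) :=
  {g | (∀ i, (g i).IsHomogeneous (d i)) ∧ (∀ i, eval x (g i) = 0) ∧
    ∃ u : Fin q → ℝ, u ≠ 0 ∧ ∀ w : Fin (n + 1) → ℝ, (∑ j, w j * x j = 0) →
      (∑ i, u i * ∑ j, w j * eval x (pderiv j (g i))) = 0}


lemma vnorm_nonneg' {m : ℕ} (v : Fin m → ℝ) : 0 ≤ vnorm v := Real.sqrt_nonneg _

lemma vnorm_sq' {m : ℕ} (v : Fin m → ℝ) : vnorm v ^ 2 = ∑ j, v j ^ 2 :=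
  Real.sq_sqrt (Finset.sum_nonneg fun _ _ => sq_nonneg _)

lemma vnorm_sq_dot {m : ℕ} (v : Fin m → ℝ) : vnorm v ^ 2 = v ⬝ᵥ v := by
  rw [vnorm_sq']; exact Finset.sum_congr rfl fun _ _ => by ring

lemma vnorm_zero' {m : ℕ} : vnorm (fun _ : Fin m => (0 : ℝ)) = 0 := by simp [vnorm]

lemma abs_le_vnorm {m : ℕ} (v : Fin m → ℝ) (i : Fin m) : |v i| ≤ vnorm v := by
  apply Real.abs_le_sqrt
  exact Finset.single_le_sum (f := fun j => v j ^ 2) (fun _ _ => sq_nonneg _) (Finset.mem_univ i)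

lemma vnorm_le_sum {m : ℕ} (v : Fin m → ℝ) : vnorm v ≤ ∑ i, |v i| := by
  have h0 : 0 ≤ ∑ i, |v i| := Finset.sum_nonneg fun _ _ => abs_nonneg _
  refine Real.sqrt_le_iff.2 ⟨h0, ?_⟩
  rw [sq, Finset.sum_mul]
  refine Finset.sum_le_sum fun i _ => ?_
  rw [← sq_abs, sq]
  exact mul_le_mul_of_nonneg_left
    (Finset.single_le_sum (f := fun j => |v j|) (fun _ _ => abs_nonneg _) (Finset.mem_univ i))
    (abs_nonneg _)

lemma abs_dot_le {m : ℕ} (u v : Fin m → ℝ) : |u ⬝ᵥ v| ≤ vnorm u * vnorm v := by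
  rw [vnorm, vnorm, ← Real.sqrt_mul (Finset.sum_nonneg fun _ _ => sq_nonneg _)]
  exact Real.abs_le_sqrt (Finset.sum_mul_sq_le_sq_mul_sq _ _ _)

lemma vnorm_smul' {m : ℕ} (c : ℝ) (v : Fin m → ℝ) : vnorm (c • v) = |c| * vnorm v := by
  rw [vnorm, vnorm, ← Real.sqrt_sq_eq_abs, ← Real.sqrt_mul (sq_nonneg c), Finset.mul_sum]
  simp [mul_pow]

lemma vnorm_pos' {m : ℕ} (v : Fin m → ℝ) (hv : v ≠ 0) : 0 < vnorm v := by
  obtain ⟨i, hi⟩ := Function.ne_iff.1 hv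
  exact lt_of_lt_of_le (abs_pos.2 hi) (abs_le_vnorm v i)

lemma bessel {m : ℕ} (y w z : Fin m → ℝ) (hy : y ⬝ᵥ y = 1) (hw : w ⬝ᵥ w ≤ 1)
    (hwy : w ⬝ᵥ y = 0) : (y ⬝ᵥ z) ^ 2 + (w ⬝ᵥ z) ^ 2 ≤ z ⬝ᵥ z := by
  set p := y ⬝ᵥ z with hp
  set t := w ⬝ᵥ z with ht
  have h := dotProduct_self_star_nonneg (z - p • y - t • w)
  simp only [star_trivial, sub_dotProduct, dotProduct_sub, smul_dotProduct, dotProduct_smul,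
    smul_eq_mul, dotProduct_comm z y, dotProduct_comm z w, dotProduct_comm y w, hy, hwy,
    ← hp, ← ht] at h
  nlinarith [mul_le_mul_of_nonneg_left hw (sq_nonneg t)]

lemma contr_dot {m : ℕ} (x v y w : Fin m → ℝ) (hx : x ⬝ᵥ x = 1) (hv : v ⬝ᵥ v ≤ 1)
    (hvx : v ⬝ᵥ x = 0) (hy : y ⬝ᵥ y = 1) (hw : w ⬝ᵥ w ≤ 1) (hwy : w ⬝ᵥ y = 0) (α β : ℝ) :
    ((x ⬝ᵥ y) * α + (v ⬝ᵥ y) * β) ^ 2 + ((x ⬝ᵥ w) * α + (v ⬝ᵥ w) * β) ^ 2 ≤ α ^ 2 + β ^ 2 := by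
  have h := bessel y w (α • x + β • v) hy hw hwy
  simp only [add_dotProduct, dotProduct_add, smul_dotProduct, dotProduct_smul,
    smul_eq_mul, dotProduct_comm y x, dotProduct_comm y v, dotProduct_comm w x,
    dotProduct_comm w v, dotProduct_comm x v, hx, hvx] at h
  nlinarith [mul_le_mul_of_nonneg_left hv (sq_nonneg β)]

/-- The two-dimensional block of the symmetric power of a contraction is a contraction. -/
lemma block_contr (c s c' s' : ℝ)
    (hP : ∀ α β : ℝ, (c * α + s * β) ^ 2 + (c' * α + s' * β) ^ 2 ≤ α ^ 2 + β ^ 2) (k : ℕ) :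
    ∀ a b : ℝ, (a * c ^ (k + 1) + √((k : ℝ) + 1) * b * (c ^ k * s)) ^ 2 +
      (√((k : ℝ) + 1) * a * (c ^ k * c') + b * (k * c ^ (k - 1) * s * c' + c ^ k * s')) ^ 2
        ≤ a ^ 2 + b ^ 2 := by
  induction k with
  | zero =>
    intro a b
    have := hP a b
    simp
    nlinarith
  | succ k ih =>
    intro a b
    have hk : (0 : ℝ) < (k : ℝ) + 2 := by positivity
    obtain ⟨r, hr0, hr⟩ : ∃ r : ℝ, 0 < r ∧ r ^ 2 = (k : ℝ) + 2 :=
      ⟨√((k : ℝ) + 2), Real.sqrt_pos.2 hk, Real.sq_sqrt hk.le⟩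
    have hr' : √(((k + 1 : ℕ) : ℝ) + 1) = r := by
      rw [← Real.sqrt_sq hr0.le, hr]; congr 1; push_cast; ring
    obtain ⟨e, he0, he, hes⟩ : ∃ e : ℝ, 0 ≤ e ∧ e ^ 2 = (k : ℝ) + 1 ∧ √((k : ℝ) + 1) = e :=
      ⟨√((k : ℝ) + 1), Real.sqrt_nonneg _, Real.sq_sqrt (by positivity), rfl⟩
    rw [hr']
    rw [hes] at ih
    have h1 := ih a (e / r * b)
    have h2 := ih (b / r) 0
    set p0 := a * c ^ (k + 1) + e * (e / r * b) * (c ^ k * s) with hp0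
    set p1 := e * a * (c ^ k * c') + e / r * b * (k * c ^ (k - 1) * s * c' + c ^ k * s') with hp1
    set r0 := b / r * c ^ (k + 1) + e * 0 * (c ^ k * s) with hr0'
    set r1 := e * (b / r) * (c ^ k * c') + 0 * (k * c ^ (k - 1) * s * c' + c ^ k * s') with hr1
    have h3 := hP p0 r0
    have h4 := hP p1 r1
    have hpow : (k : ℝ) * c ^ (k - 1) * c = k * c ^ k := by
      cases k with
      | zero => simp
      | succ m => simp [pow_succ]; ring
    have hF : a * c ^ (k + 1 + 1) + r * b * (c ^ (k + 1) * s) = c * p0 + s * r0 := by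
      have : r * b = e ^ 2 * b / r + b / r := by
        field_simp; rw [hr, he]; ring
      rw [this, hp0, hr0']; ring
    have hG : r * a * (c ^ (k + 1) * c') + b * (((k + 1 : ℕ) : ℝ) * c ^ (k + 1 - 1) * s * c'
        + c ^ (k + 1) * s') = e / r * (c * p1 + s * r1) + 1 / r * (c' * p0 + s' * r0) := by
      have e1 : e / r * (c * p1 + s * r1) = e ^ 2 / r * a * c ^ (k + 1) * c' +
          e ^ 2 / r ^ 2 * b * ((k * c ^ (k - 1) * c) * s * c' + c ^ (k + 1) * s')
          + e ^ 2 / r ^ 2 * b * c ^ k * s * c' := by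
        rw [hp1, hr1]; field_simp; ring
      have e2 : 1 / r * (c' * p0 + s' * r0) = 1 / r * a * c ^ (k + 1) * c' +
          e ^ 2 / r ^ 2 * b * c ^ k * s * c' + 1 / r ^ 2 * b * c ^ (k + 1) * s' := by
        rw [hp0, hr0']; field_simp; ring
      rw [e1, e2, hpow, he, hr]
      have hrr : r = ((k : ℝ) + 1) / r + 1 / r := by
        field_simp; rw [hr]; ring
      have hk' : (k : ℝ) + 2 ≠ 0 := hk.ne'
      nth_rewrite 1 [hrr]
      push_cast
      field_simp
      ring
    rw [hF, hG]
    have hb : a ^ 2 + (e / r * b) ^ 2 + ((b / r) ^ 2 + 0 ^ 2) = a ^ 2 + b ^ 2 := by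
      field_simp; rw [he, hr]; ring
    have hcs : (e / r * (c * p1 + s * r1) + 1 / r * (c' * p0 + s' * r0)) ^ 2 ≤
        (c * p1 + s * r1) ^ 2 + (c' * p0 + s' * r0) ^ 2 := by
      have hu : (e / r) ^ 2 + (1 / r) ^ 2 = 1 := by
        field_simp; rw [he, hr]; ring
      generalize e / r = l at *
      generalize 1 / r = m at *
      generalize (c * p1 + s * r1) = A at *
      generalize (c' * p0 + s' * r0) = B at *
      have : A ^ 2 + B ^ 2 = (l ^ 2 + m ^ 2) * (A ^ 2 + B ^ 2) := by rw [hu, one_mul]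
      have h5 : (l ^ 2 + m ^ 2) * (A ^ 2 + B ^ 2) - (l * A + m * B) ^ 2 = (l * B - m * A) ^ 2 := by
        ring
      have h6 := sq_nonneg (l * B - m * A)
      rw [this]; linarith
    have h7 := sq_nonneg (c' * p1 + s' * r1)
    clear_value p0 p1 r0 r1
    linarith

/-- The linear form `⟨x, X⟩`. -/
noncomputable def linForm {m : ℕ} (x : Fin m → ℝ) : MvPolynomial (Fin m) ℝ := ∑ j, C (x j) * X j

lemma linForm_hom {m : ℕ} (x : Fin m → ℝ) : (linForm x).IsHomogeneous 1 := by
  refine IsHomogeneous.sum _ _ _ fun j _ => ?_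
  simpa using (isHomogeneous_C (Fin m) (x j)).mul (isHomogeneous_X ℝ j)

lemma eval_linForm {m : ℕ} (x y : Fin m → ℝ) : eval y (linForm x) = x ⬝ᵥ y := by
  simp [linForm, dotProduct]

lemma pderiv_linForm {m : ℕ} (x : Fin m → ℝ) (j : Fin m) : pderiv j (linForm x) = C (x j) := by
  classical
  simp [linForm, pderiv_X, Pi.single_apply]

/-- The perturbation polynomial. -/
noncomputable def pert {m : ℕ} (x v : Fin m → ℝ) (a b : ℝ) (d : ℕ) : MvPolynomial (Fin m) ℝ :=
  C a * linForm x ^ d + C (√(d : ℝ) * b) * (linForm x ^ (d - 1) * linForm v)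

lemma pert_hom {m : ℕ} (x v : Fin m → ℝ) (a b : ℝ) (d : ℕ) (hd : 1 ≤ d) :
    (pert x v a b d).IsHomogeneous d := by
  obtain ⟨k, rfl⟩ : ∃ k, d = k + 1 := ⟨d - 1, by omega⟩
  refine IsHomogeneous.add ?_ ?_
  · simpa using (isHomogeneous_C (Fin m) a).mul ((linForm_hom x).pow (k + 1))
  · simpa using (isHomogeneous_C (Fin m) (√((k + 1 : ℕ) : ℝ) * b)).mul
      (((linForm_hom x).pow k).mul (linForm_hom v))

lemma eval_pert {m : ℕ} (x v y : Fin m → ℝ) (a b : ℝ) (k : ℕ) :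
    eval y (pert x v a b (k + 1)) =
      a * (x ⬝ᵥ y) ^ (k + 1) + √((k : ℝ) + 1) * b * ((x ⬝ᵥ y) ^ k * (v ⬝ᵥ y)) := by
  simp [pert, eval_linForm]

lemma deriv_pert {m : ℕ} (x v y w : Fin m → ℝ) (a b : ℝ) (k : ℕ) :
    ∑ j, w j * eval y (pderiv j (pert x v a b (k + 1))) =
      √((k : ℝ) + 1) * (√((k : ℝ) + 1) * a * ((x ⬝ᵥ y) ^ k * (x ⬝ᵥ w)) +
        b * (k * (x ⬝ᵥ y) ^ (k - 1) * (v ⬝ᵥ y) * (x ⬝ᵥ w) + (x ⬝ᵥ y) ^ k * (v ⬝ᵥ w))) := by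
  have hs : √((k : ℝ) + 1) * √((k : ℝ) + 1) = (k : ℝ) + 1 := Real.mul_self_sqrt (by positivity)
  have h : ∀ j, w j * eval y (pderiv j (pert x v a b (k + 1))) =
      (((k : ℝ) + 1) * a * (x ⬝ᵥ y) ^ k + √((k : ℝ) + 1) * b *
        (k * (x ⬝ᵥ y) ^ (k - 1) * (v ⬝ᵥ y))) * (x j * w j) +
      √((k : ℝ) + 1) * b * (x ⬝ᵥ y) ^ k * (v j * w j) := by
    intro j
    simp [pert, pderiv_linForm, eval_linForm]
    ring
  rw [Finset.sum_congr rfl fun j _ => h j, Finset.sum_add_distrib, ← Finset.mul_sum,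
    ← Finset.mul_sum]
  change _ * (x ⬝ᵥ w) + _ * (v ⬝ᵥ w) = _
  linear_combination (-(a * (x ⬝ᵥ y) ^ k * (x ⬝ᵥ w))) * hs

lemma pert_bound {m : ℕ} (x v y w : Fin m → ℝ) (hx : x ⬝ᵥ x = 1) (hv : v ⬝ᵥ v ≤ 1)
    (hvx : v ⬝ᵥ x = 0) (hy : y ⬝ᵥ y = 1) (hw : w ⬝ᵥ w ≤ 1) (hwy : w ⬝ᵥ y = 0)
    (a b : ℝ) (d : ℕ) (hd : 1 ≤ d) :
    eval y (pert x v a b d) ^ 2 +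
      ((√(d : ℝ))⁻¹ * ∑ j, w j * eval y (pderiv j (pert x v a b d))) ^ 2 ≤ a ^ 2 + b ^ 2 := by
  obtain ⟨k, rfl⟩ : ∃ k, d = k + 1 := ⟨d - 1, by omega⟩
  have hs : √((k : ℝ) + 1) ≠ 0 := (Real.sqrt_pos.2 (by positivity)).ne'
  rw [eval_pert, deriv_pert]
  push_cast
  rw [inv_mul_cancel_left₀ hs]
  exact block_contr _ _ _ _ (contr_dot x v y w hx hv hvx hy hw hwy) k a b

lemma deriv_pert_self {m : ℕ} (x v w : Fin m → ℝ) (hx : x ⬝ᵥ x = 1)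
    (hvx : v ⬝ᵥ x = 0) (hwx : w ⬝ᵥ x = 0) (a b : ℝ) (d : ℕ) (hd : 1 ≤ d) :
    ∑ j, w j * eval x (pderiv j (pert x v a b d)) = √(d : ℝ) * (b * (v ⬝ᵥ w)) := by
  obtain ⟨k, rfl⟩ : ∃ k, d = k + 1 := ⟨d - 1, by omega⟩
  rw [deriv_pert, dotProduct_comm x w, hx, hvx, hwx]
  push_cast
  simp

lemma eval_pert_self {m : ℕ} (x v : Fin m → ℝ) (hx : x ⬝ᵥ x = 1)
    (hvx : v ⬝ᵥ x = 0) (a b : ℝ) (d : ℕ) (hd : 1 ≤ d) :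
    eval x (pert x v a b d) = a := by
  obtain ⟨k, rfl⟩ : ∃ k, d = k + 1 := ⟨d - 1, by omega⟩
  rw [eval_pert, hx, hvx]; simp

lemma dot_self_of_vnorm {m : ℕ} {y : Fin m → ℝ} (hy : vnorm y = 1) : y ⬝ᵥ y = 1 := by
  rw [← vnorm_sq_dot, hy]; norm_num

lemma dot_self_of_vnorm_le {m : ℕ} {y : Fin m → ℝ} (hy : vnorm y ≤ 1) : y ⬝ᵥ y ≤ 1 := by
  rw [← vnorm_sq_dot]; nlinarith [vnorm_nonneg' y]

lemma vnorm_le_of_dot {m : ℕ} {y : Fin m → ℝ} (hy : y ⬝ᵥ y ≤ 1) : vnorm y ≤ 1 := by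
  rw [← vnorm_sq_dot] at hy; nlinarith [vnorm_nonneg' y]

lemma nonempty_tangent {m : ℕ} (y : Fin m → ℝ) :
    Nonempty {w : Fin m → ℝ // vnorm w ≤ 1 ∧ ∑ j, w j * y j = 0} :=
  ⟨⟨fun _ => 0, by rw [vnorm_zero']; norm_num, by simp⟩⟩

/-- Upper bound for the norm of a perturbation. -/
lemma normInfD_pert_le {n q : ℕ} (d : Fin q → ℕ) (hd : ∀ i, 1 ≤ d i)
    (x v : Fin (n + 1) → ℝ) (hx : vnorm x = 1) (hv : v ⬝ᵥ v ≤ 1) (hvx : v ⬝ᵥ x = 0)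
    (a b : Fin q → ℝ) :
    normInfD d (fun i => pert x v (a i) (b i) (d i)) ≤ √(vnorm a ^ 2 + vnorm b ^ 2) := by
  have : Nonempty {y : Fin (n + 1) → ℝ // vnorm y = 1} := ⟨⟨x, hx⟩⟩
  refine ciSup_le fun ⟨y, hy⟩ => ?_
  apply Real.sqrt_le_sqrt
  have := nonempty_tangent y
  have key : ∀ w : {w : Fin (n + 1) → ℝ // vnorm w ≤ 1 ∧ ∑ j, w j * y j = 0},
      (vnorm fun i => eval y (pert x v (a i) (b i) (d i))) ^ 2 +
      (vnorm fun i => (√(d i : ℝ))⁻¹ *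
        ∑ j, w.1 j * eval y (pderiv j (pert x v (a i) (b i) (d i)))) ^ 2
      ≤ vnorm a ^ 2 + vnorm b ^ 2 := by
    intro ⟨w, hw, hwy⟩
    simp only [vnorm_sq']
    rw [← Finset.sum_add_distrib, ← Finset.sum_add_distrib]
    exact Finset.sum_le_sum fun i _ => pert_bound x v y w (dot_self_of_vnorm hx) hv hvx
      (dot_self_of_vnorm hy) (dot_self_of_vnorm_le hw) hwy _ _ _ (hd i)
  set E := (vnorm fun i => eval y (pert x v (a i) (b i) (d i))) ^ 2 with hE
  have h0 : 0 ≤ vnorm a ^ 2 + vnorm b ^ 2 - E := by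
    have := key (Classical.arbitrary _)
    nlinarith [sq_nonneg (vnorm fun i => (√(d i : ℝ))⁻¹ *
        ∑ j, (Classical.arbitrary {w : Fin (n + 1) → ℝ // vnorm w ≤ 1 ∧ ∑ j, w j * y j = 0}).1 j
          * eval y (pderiv j (pert x v (a i) (b i) (d i))))]
  have hle : scaledDerivNorm d y (fun i => pert x v (a i) (b i) (d i)) ≤
      √(vnorm a ^ 2 + vnorm b ^ 2 - E) := by
    refine ciSup_le fun w => ?_
    apply Real.le_sqrt_of_sq_le
    linarith [key w]
  have hnn : 0 ≤ scaledDerivNorm d y (fun i => pert x v (a i) (b i) (d i)) :=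
    Real.iSup_nonneg fun _ => vnorm_nonneg' _
  have := pow_le_pow_left₀ hnn hle 2
  rw [Real.sq_sqrt h0] at this
  linarith

/-- Crude bound on the scaled derivative. -/
lemma deriv_le_crude {n q : ℕ} (d : Fin q → ℕ) (y : Fin (n + 1) → ℝ)
    (h : Fin q → MvPolynomial (Fin (n + 1)) ℝ)
    (w : {w : Fin (n + 1) → ℝ // vnorm w ≤ 1 ∧ ∑ j, w j * y j = 0}) :
    (vnorm fun i => (√(d i : ℝ))⁻¹ * ∑ j, w.1 j * eval y (pderiv j (h i))) ≤
      ∑ i, (√(d i : ℝ))⁻¹ * ∑ j, |eval y (pderiv j (h i))| := by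
  refine (vnorm_le_sum _).trans (Finset.sum_le_sum fun i _ => ?_)
  rw [abs_mul, abs_of_nonneg (inv_nonneg.2 (Real.sqrt_nonneg _))]
  refine mul_le_mul_of_nonneg_left ?_ (inv_nonneg.2 (Real.sqrt_nonneg _))
  refine (Finset.abs_sum_le_sum_abs _ _).trans (Finset.sum_le_sum fun j _ => ?_)
  rw [abs_mul]
  exact mul_le_of_le_one_left (abs_nonneg _) ((abs_le_vnorm w.1 j).trans w.2.1)

lemma bdd_deriv {n q : ℕ} (d : Fin q → ℕ) (y : Fin (n + 1) → ℝ)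
    (h : Fin q → MvPolynomial (Fin (n + 1)) ℝ) :
    BddAbove (Set.range fun w : {w : Fin (n + 1) → ℝ // vnorm w ≤ 1 ∧ ∑ j, w j * y j = 0} =>
      vnorm fun i => (√(d i : ℝ))⁻¹ * ∑ j, w.1 j * eval y (pderiv j (h i))) :=
  ⟨_, by rintro _ ⟨w, rfl⟩; exact deriv_le_crude d y h w⟩

lemma bdd_normInfD {n q : ℕ} (d : Fin q → ℕ) (h : Fin q → MvPolynomial (Fin (n + 1)) ℝ) :
    BddAbove (Set.range fun y : {y : Fin (n + 1) → ℝ // vnorm y = 1} =>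
      √((vnorm fun i => eval y.1 (h i)) ^ 2 + scaledDerivNorm d y.1 h ^ 2)) := by
  have hc : Continuous fun y : Fin (n + 1) → ℝ => √((vnorm fun i => eval y (h i)) ^ 2 +
      (∑ i, (√(d i : ℝ))⁻¹ * ∑ j, |eval y (pderiv j (h i))|) ^ 2) := by
    have he : ∀ p : MvPolynomial (Fin (n + 1)) ℝ, Continuous fun y : Fin (n + 1) → ℝ => eval y p :=
      fun p => MvPolynomial.continuous_eval p
    unfold vnorm
    fun_prop
  obtain ⟨M, hM⟩ := (isCompact_Icc (a := fun _ : Fin (n + 1) => (-1 : ℝ))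
    (b := fun _ => 1)).bddAbove_image hc.continuousOn
  refine ⟨M, ?_⟩
  rintro _ ⟨⟨y, hy⟩, rfl⟩
  have hmem : y ∈ Set.Icc (fun _ : Fin (n + 1) => (-1 : ℝ)) (fun _ => 1) := by
    have := fun i => abs_le.1 ((abs_le_vnorm y i).trans hy.le)
    exact ⟨fun i => (this i).1, fun i => (this i).2⟩
  refine le_trans ?_ (hM ⟨y, hmem, rfl⟩)
  apply Real.sqrt_le_sqrt
  have hnn : 0 ≤ scaledDerivNorm d y h := Real.iSup_nonneg fun _ => vnorm_nonneg' _
  have := nonempty_tangent y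
  have hle : scaledDerivNorm d y h ≤ _ := ciSup_le (deriv_le_crude d y h)
  have := pow_le_pow_left₀ hnn hle 2
  simpa using this

/-- Lower bound. -/
lemma lower_bound {n q : ℕ} (d : Fin q → ℕ) (hd : ∀ i, 1 ≤ d i)
    (f : Fin q → MvPolynomial (Fin (n + 1)) ℝ)
    (x : Fin (n + 1) → ℝ) (hx : vnorm x = 1) (g : Fin q → MvPolynomial (Fin (n + 1)) ℝ)
    (hg : g ∈ SingularAt d x) :
    √((vnorm fun i => eval x (f i)) ^ 2 + sigmaMinHalf d x f ^ 2) ≤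
      normInfD d (fun i => f i - g i) := by
  obtain ⟨-, hg0, u, hu0, hu⟩ := hg
  refine le_trans ?_ (le_ciSup (bdd_normInfD d (fun i => f i - g i)) ⟨x, hx⟩)
  apply Real.sqrt_le_sqrt
  have hσ : 0 ≤ sigmaMinHalf d x f :=
    Real.iInf_nonneg fun _ => Real.iSup_nonneg fun _ => abs_nonneg _
  simp only [map_sub, hg0, sub_zero]
  have hds : ∀ i, √(d i : ℝ) ≠ 0 := fun i =>
    (Real.sqrt_pos.2 (by exact_mod_cast (hd i))).ne'
  suffices sigmaMinHalf d x f ≤ scaledDerivNorm d x (fun i => f i - g i) by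
    have := pow_le_pow_left₀ hσ this 2
    linarith
  set v : Fin q → ℝ := fun i => √(d i : ℝ) * u i with hv
  have hv0 : v ≠ 0 := by
    obtain ⟨i, hi⟩ := Function.ne_iff.1 hu0
    exact Function.ne_iff.2 ⟨i, mul_ne_zero (hds i) hi⟩
  have hvp := vnorm_pos' v hv0
  set v' := (vnorm v)⁻¹ • v with hv'
  have hv1 : vnorm v' = 1 := by
    rw [hv', vnorm_smul', abs_of_pos (inv_pos.2 hvp), inv_mul_cancel₀ hvp.ne']
  have hb : BddBelow (Set.range fun u : {u : Fin q → ℝ // vnorm u = 1} =>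
      ⨆ w : {w : Fin (n + 1) → ℝ // vnorm w ≤ 1 ∧ ∑ j, w j * x j = 0},
      |∑ i, u.1 i * ((√(d i : ℝ))⁻¹ * ∑ j, w.1 j * eval x (pderiv j (f i)))|) :=
    ⟨0, by rintro _ ⟨u, rfl⟩; exact Real.iSup_nonneg fun _ => abs_nonneg _⟩
  refine (ciInf_le hb ⟨v', hv1⟩).trans ?_
  have := nonempty_tangent x
  refine ciSup_le fun w => ?_
  refine le_trans ?_ (le_ciSup (bdd_deriv d x (fun i => f i - g i)) w)
  obtain ⟨w, hw⟩ := w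
  dsimp only
  have hz : ∑ i, v' i * ((√(d i : ℝ))⁻¹ * ∑ j, w j * eval x (pderiv j (g i))) = 0 := by
    have := hu w hw.2
    rw [← mul_zero (vnorm v)⁻¹, ← this, Finset.mul_sum]
    refine Finset.sum_congr rfl fun i _ => ?_
    have := hds i
    simp only [hv', hv, Pi.smul_apply, smul_eq_mul]
    field_simp
  have he : ∑ i, v' i * ((√(d i : ℝ))⁻¹ * ∑ j, w j * eval x (pderiv j (f i))) =
      v' ⬝ᵥ fun i => (√(d i : ℝ))⁻¹ * ∑ j, w j * eval x (pderiv j (f i - g i)) := by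
    rw [← sub_zero (Finset.sum _ _), ← hz, ← Finset.sum_sub_distrib]
    refine Finset.sum_congr rfl fun i _ => ?_
    simp only [map_sub, mul_sub, Finset.sum_sub_distrib]
  rw [he]
  have := abs_dot_le v' fun i => (√(d i : ℝ))⁻¹ * ∑ j, w j * eval x (pderiv j (f i - g i))
  rwa [hv1, one_mul] at this

/-- Upper bound: for every unit vector there is a singular system at suitable distance. -/
lemma upper_bound {n q : ℕ} (d : Fin q → ℕ) (hd : ∀ i, 1 ≤ d i)
    (f : Fin q → MvPolynomial (Fin (n + 1)) ℝ) (hf : ∀ i, (f i).IsHomogeneous (d i))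
    (x : Fin (n + 1) → ℝ) (hx : vnorm x = 1) (u : Fin q → ℝ) (hu : vnorm u = 1) :
    ∃ g ∈ SingularAt d x, normInfD d (fun i => f i - g i) ≤
      √((vnorm fun i => eval x (f i)) ^ 2 +
      (⨆ w : {w : Fin (n + 1) → ℝ // vnorm w ≤ 1 ∧ ∑ j, w j * x j = 0},
      |∑ i, u i * ((√(d i : ℝ))⁻¹ * ∑ j, w.1 j * eval x (pderiv j (f i)))|) ^ 2) := by
  have hxx := dot_self_of_vnorm hx
  have hds : ∀ i, √(d i : ℝ) ≠ 0 := fun i =>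
    (Real.sqrt_pos.2 (by exact_mod_cast (hd i))).ne'
  set V : Fin (n + 1) → ℝ := fun j => ∑ i, u i * ((√(d i : ℝ))⁻¹ * eval x (pderiv j (f i))) with hV
  have hVw : ∀ w : Fin (n + 1) → ℝ,
      ∑ i, u i * ((√(d i : ℝ))⁻¹ * ∑ j, w j * eval x (pderiv j (f i))) = V ⬝ᵥ w := by
    intro w
    simp only [dotProduct, hV, Finset.mul_sum, Finset.sum_mul]
    rw [Finset.sum_comm]
    exact Finset.sum_congr rfl fun _ _ => Finset.sum_congr rfl fun _ _ => by ring
  set z := V - (V ⬝ᵥ x) • x with hz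
  have hzx : z ⬝ᵥ x = 0 := by
    rw [hz, sub_dotProduct, smul_dotProduct, hxx]; simp
  have hzw : ∀ w : Fin (n + 1) → ℝ, w ⬝ᵥ x = 0 → V ⬝ᵥ w = z ⬝ᵥ w := by
    intro w hw
    rw [hz, sub_dotProduct, smul_dotProduct, dotProduct_comm x w, hw]; simp
  set φ := vnorm z with hφ
  have hφ0 : 0 ≤ φ := vnorm_nonneg' z
  set v := φ⁻¹ • z with hv
  have hzz : z = φ • v := by
    by_cases h : φ = 0
    · have : z = 0 := by
        by_contra hne
        exact (vnorm_pos' z hne).ne' h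
      rw [this] at hv ⊢
      simp [hv]
    · rw [hv, smul_inv_smul₀ h]
  have hvv : vnorm v ≤ 1 := by
    rw [hv, vnorm_smul', abs_of_nonneg (inv_nonneg.2 hφ0)]
    exact inv_mul_le_one
  have hvx : v ⬝ᵥ x = 0 := by rw [hv, smul_dotProduct, hzx, smul_zero]
  have hzv : z ⬝ᵥ v = φ := by
    rw [hv, dotProduct_smul, ← vnorm_sq_dot, ← hφ, smul_eq_mul]
    by_cases h : φ = 0
    · simp [h]
    · field_simp
  have hsup : φ ≤ ⨆ w : {w : Fin (n + 1) → ℝ // vnorm w ≤ 1 ∧ ∑ j, w j * x j = 0},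
      |∑ i, u i * ((√(d i : ℝ))⁻¹ * ∑ j, w.1 j * eval x (pderiv j (f i)))| := by
    have hb : BddAbove (Set.range fun w : {w : Fin (n + 1) → ℝ // vnorm w ≤ 1 ∧
        ∑ j, w j * x j = 0} =>
        |∑ i, u i * ((√(d i : ℝ))⁻¹ * ∑ j, w.1 j * eval x (pderiv j (f i)))|) := by
      refine ⟨vnorm V, ?_⟩
      rintro _ ⟨w, rfl⟩
      simp only [hVw]
      refine (abs_dot_le V w.1).trans ?_
      exact mul_le_of_le_one_right (vnorm_nonneg' _) w.2.1
    refine le_trans ?_ (le_ciSup hb ⟨v, hvv, hvx⟩)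
    simp only [hVw]
    rw [hzw v hvx, hzv]
    exact le_abs_self _
  refine ⟨fun i => f i - pert x v (eval x (f i)) (φ * u i) (d i), ⟨?_, ?_, ?_⟩, ?_⟩
  · exact fun i => (hf i).sub (pert_hom _ _ _ _ _ (hd i))
  · intro i
    rw [map_sub, eval_pert_self x v hxx hvx _ _ _ (hd i), sub_self]
  · refine ⟨fun i => u i * (√(d i : ℝ))⁻¹, ?_, ?_⟩
    · intro h
      have : u = 0 := by
        funext i
        have := congrFun h i
        simpa [hds i] using this
      rw [this] at hu
      simp [vnorm] at hu
    · intro w hw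
      have hD : ∀ i, ∑ j, w j * eval x (pderiv j (f i - pert x v (eval x (f i)) (φ * u i) (d i)))
          = ∑ j, w j * eval x (pderiv j (f i)) - √(d i : ℝ) * (φ * u i * (v ⬝ᵥ w)) := by
        intro i
        rw [← deriv_pert_self x v w hxx hvx hw (eval x (f i)) _ _ (hd i),
          ← Finset.sum_sub_distrib]
        simp only [map_sub, mul_sub]
      have huu : ∑ i, u i ^ 2 = 1 := by rw [← vnorm_sq', hu]; norm_num
      have : ∀ i, u i * (√(d i : ℝ))⁻¹ * (∑ j, w j * eval x (pderiv j (f i))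
          - √(d i : ℝ) * (φ * u i * (v ⬝ᵥ w))) =
          u i * ((√(d i : ℝ))⁻¹ * ∑ j, w j * eval x (pderiv j (f i))) -
            u i ^ 2 * (φ * (v ⬝ᵥ w)) := by
        intro i
        have := hds i
        field_simp
      simp only [hD]
      rw [Finset.sum_congr rfl fun i _ => this i, Finset.sum_sub_distrib, hVw, ← Finset.sum_mul,
        huu, one_mul, hzw w hw, hzz, smul_dotProduct, smul_eq_mul]
      have hφv : vnorm (φ • v) = φ := by rw [← hzz]
      simp only [sub_self]
  · simp only [sub_sub_cancel]
    refine (normInfD_pert_le d hd x v hx (dot_self_of_vnorm_le hvv) hvx _ _).trans ?_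
    apply Real.sqrt_le_sqrt
    have : vnorm (fun i => φ * u i) = φ := by
      have := vnorm_smul' φ u
      rw [hu, mul_one, abs_of_nonneg hφ0] at this
      exact this
    rw [this]
    have := pow_le_pow_left₀ hφ0 hsup 2
    linarith

theorem structured_condition_number_theorem (n q : ℕ) (hn : 1 ≤ n) (hq : 1 ≤ q) (hqn : q ≤ n)
    (d : Fin q → ℕ) (hd : ∀ i, 1 ≤ d i)
    (f : Fin q → MvPolynomial (Fin (n + 1)) ℝ) (hf : ∀ i, (f i).IsHomogeneous (d i))
    (x : Fin (n + 1) → ℝ) (hx : vnorm x = 1) :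
    sInf {t : ℝ | ∃ g ∈ SingularAt d x, t = normInfD d (fun i => f i - g i)} =
      Real.sqrt ((vnorm fun i => eval x (f i)) ^ 2 + sigmaMinHalf d x f ^ 2) := by
  have hne : Nonempty {u : Fin q → ℝ // vnorm u = 1} := by
    refine ⟨⟨Pi.single ⟨0, hq⟩ 1, ?_⟩⟩
    simp [vnorm, Pi.single_apply]
  have hσ : 0 ≤ sigmaMinHalf d x f :=
    Real.iInf_nonneg fun _ => Real.iSup_nonneg fun _ => abs_nonneg _
  have hbb : BddBelow {t : ℝ | ∃ g ∈ SingularAt d x, t = normInfD d (fun i => f i - g i)} := by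
    refine ⟨√((vnorm fun i => eval x (f i)) ^ 2 + sigmaMinHalf d x f ^ 2), ?_⟩
    rintro _ ⟨g, hg, rfl⟩
    exact lower_bound d hd f x hx g hg
  apply le_antisymm
  · set S := sInf {t : ℝ | ∃ g ∈ SingularAt d x, t = normInfD d (fun i => f i - g i)} with hS
    have hS0 : 0 ≤ S := by
      apply Real.sInf_nonneg
      rintro _ ⟨g, hg, rfl⟩
      exact (Real.sqrt_nonneg _).trans (lower_bound d hd f x hx g hg)
    apply Real.le_sqrt_of_sq_le
    have : √(S ^ 2 - (vnorm fun i => eval x (f i)) ^ 2) ≤ sigmaMinHalf d x f := by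
      refine le_ciInf fun ⟨u, hu⟩ => ?_
      obtain ⟨g, hg, hle⟩ := upper_bound d hd f hf x hx u hu
      have h1 : S ≤ _ := (csInf_le hbb ⟨g, hg, rfl⟩).trans hle
      refine Real.sqrt_le_iff.2 ⟨Real.iSup_nonneg fun _ => abs_nonneg _, ?_⟩
      have h2 := pow_le_pow_left₀ hS0 h1 2
      rw [Real.sq_sqrt (by positivity)] at h2
      linarith
    have := (Real.sqrt_le_iff.1 this).2
    linarith
  · obtain ⟨⟨u, hu⟩⟩ := hne
    obtain ⟨g, hg, -⟩ := upper_bound d hd f hf x hx u hu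
    refine le_csInf ⟨_, g, hg, rfl⟩ ?_
    rintro _ ⟨g, hg, rfl⟩
    exact lower_bound d hd f x hx g hg
end
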